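/- arXiv:math/0004137 — 3 statements merged into one kernel-verified Lean document; each statement's English description precedes it below -/
import Mathlib

section
/- (Pieri rule for the coproduct coefficients) Let λ and μ be partitions and k ≥ 1 an integer. If μ ⊆ λ and λ/μ is a horizontal strip, then d^λ_{μ,(k)} = (−1)^{k−|λ/μ|}·C(r, k−|λ/μ|), where λ̄ = (λ_2, λ_3, …) is λ with its top row removed (note λ̄ ⊆ μ when λ/μ is a horizontal strip), r is the number of nonempty rows of the skew diagram μ/λ̄, and C(r,j) denotes the binomial coefficient (equal to 0 when j < 0 or j > r). If μ ⊄ λ or λ/μ is not a horizontal strip, then d^λ_{μ,(k)} = 0. -/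
open MvPolynomial

/-- A set-valued tableau on an arbitrary finite set of boxes `(row, column)`.
Entries are `0`-based: the entry `i : ℕ` stands for the integer `i + 1`
(equivalently, for the variable `x_{i+1}`).  Rows weakly increase from left to
right and columns strictly increase from top to bottom, expressed via
horizontally and vertically adjacent boxes. -/
structure SVT (cells : Finset (ℕ × ℕ)) where
  entry : ℕ × ℕ → Finset ℕ
  nonempty_of_mem : ∀ c ∈ cells, (entry c).Nonempty
  eq_empty_of_not_mem : ∀ c, c ∉ cells → entry c = ∅
  row_weak : ∀ i j, (i, j) ∈ cells → (i, j + 1) ∈ cells →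
    ∀ a ∈ entry (i, j), ∀ b ∈ entry (i, j + 1), a ≤ b
  col_strict : ∀ i j, (i, j) ∈ cells → (i + 1, j) ∈ cells →
    ∀ a ∈ entry (i, j), ∀ b ∈ entry (i + 1, j), a < b

namespace SVT

variable {cells : Finset (ℕ × ℕ)}

/-- `|T|`: the total number of integers in the boxes of `T`. -/
def size (T : SVT cells) : ℕ := ∑ c ∈ cells, (T.entry c).card

/-- `T` has all its entries among `{1, …, m}` (i.e. `0`-based entries `< m`). -/
def Bounded (T : SVT cells) (m : ℕ) : Prop := ∀ c, ∀ x ∈ T.entry c, x < m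

/-- The monomial `x^T`, where the exponent of the variable `i` is the number of
boxes of `T` containing `i`. -/
noncomputable def monomial (T : SVT cells) : MvPolynomial ℕ ℤ :=
  ∏ c ∈ cells, ∏ i ∈ T.entry c, X i

/-- The column word of `T`: columns are read from left to right, each column
from bottom to top, the integers within a box in increasing order. -/
def word (T : SVT cells) : List ℕ :=
  (List.range ((cells.sup fun c => max c.1 c.2) + 1)).flatMap fun j =>
    ((List.range ((cells.sup fun c => max c.1 c.2) + 1)).reverse).flatMap fun i =>
      (T.entry (i, j)).sort (· ≤ ·)

end SVT

/-- The stable Grothendieck polynomial of the shape given by `cells`, in the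
variables `x_1, …, x_m` (`0`-based: variables `0, …, m-1`):
`G(cells) = ∑_T (-1)^(|T| - #cells) x^T` over set-valued tableaux `T` of shape
`cells` with entries in `{1, …, m}`. -/
noncomputable def grothendieck (cells : Finset (ℕ × ℕ)) (m : ℕ) : MvPolynomial ℕ ℤ :=
  ∑ᶠ (T : SVT cells) (_ : T.Bounded m), ((-1 : ℤ) ^ (T.size - cells.card)) • T.monomial

/-- A reverse lattice word: every suffix contains, for each `i`, at least as
many occurrences of `i` as of `i + 1`. -/
def IsRLW (w : List ℕ) : Prop := ∀ s, s <:+ w → ∀ i, s.count (i + 1) ≤ s.count i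

/-- A partial reverse lattice word with respect to the (`0`-based, half-open)
interval `[a, b)`:  every suffix contains, for each `t` with `a ≤ t` and
`t + 1 < b`, at least as many occurrences of `t` as of `t + 1`. -/
def IsPartialRLW (a b : ℕ) (w : List ℕ) : Prop :=
  ∀ s, s <:+ w → ∀ t, a ≤ t → t + 1 < b → s.count (t + 1) ≤ s.count t

/-- `w` has content `ν`: the number of occurrences of `i` in `w` is the length
of the `i`-th row of `ν`. -/
def HasContent (w : List ℕ) (nu : YoungDiagram) : Prop := ∀ i, w.count i = nu.rowLen i

/-- The cells of the skew diagram `λ * μ`, obtained by placing `λ` and `μ`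
corner to corner: `λ` occupies rows `0, …, ℓ(λ)-1` shifted right by `μ₁`
columns, and `μ` occupies the rows below row `ℓ(λ)-1`. -/
def starCells (lam mu : YoungDiagram) : Finset (ℕ × ℕ) :=
  (lam.cells.image fun c => (c.1, c.2 + mu.rowLen 0)) ∪
    (mu.cells.image fun c => (c.1 + lam.colLen 0, c.2))

/-- The structure constant `c^ν_{λμ}`: `(-1)^(|ν|-|λ|-|μ|)` times the number of
set-valued tableaux of shape `λ * μ` whose word is a reverse lattice word with
content `ν`. -/
noncomputable def cLR (lam mu nu : YoungDiagram) : ℤ :=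
  (-1 : ℤ) ^ (nu.card - lam.card - mu.card) *
    (Nat.card {T : SVT (starCells lam mu) // IsRLW T.word ∧ HasContent T.word nu} : ℤ)

/-- The coproduct structure constant `d^ν_{λμ}`: `(-1)^(|λ|+|μ|-|ν|)` times the
number of set-valued tableaux of shape `ν` whose word is a partial reverse
lattice word with respect to both intervals `[1, ℓ(λ)]` and
`[ℓ(λ)+1, ℓ(λ)+ℓ(μ)]` and has content `(λ₁, …, λ_{ℓ(λ)}, μ₁, …, μ_{ℓ(μ)})`. -/
noncomputable def dCoeff (lam mu nu : YoungDiagram) : ℤ :=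
  (-1 : ℤ) ^ (lam.card + mu.card - nu.card) *
    (Nat.card {T : SVT nu.cells //
      IsPartialRLW 0 (lam.colLen 0) T.word ∧
      IsPartialRLW (lam.colLen 0) (lam.colLen 0 + mu.colLen 0) T.word ∧
      ∀ i, T.word.count i =
        if i < lam.colLen 0 then lam.rowLen i else mu.rowLen (i - lam.colLen 0)} : ℤ)

/-- The coefficient `α_{θ,μ}` for a shape `θ` given by `cells`:
`(-1)^(|μ|-|θ|)` times the number of set-valued tableaux of shape `θ` whose
word is a reverse lattice word with content `μ`. -/
noncomputable def alphaCoeff (cells : Finset (ℕ × ℕ)) (mu : YoungDiagram) : ℤ :=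
  (-1 : ℤ) ^ (mu.card - cells.card) *
    (Nat.card {T : SVT cells // IsRLW T.word ∧ HasContent T.word mu} : ℤ)

/-- `ν/λ` is a vertical strip: at most one box in each row. -/
def IsVerticalStrip (lam nu : YoungDiagram) : Prop := ∀ i, nu.rowLen i ≤ lam.rowLen i + 1

/-- `ν/λ` is a horizontal strip: at most one box in each column. -/
def IsHorizontalStrip (lam nu : YoungDiagram) : Prop := ∀ j, nu.colLen j ≤ lam.colLen j + 1

/-- A set of boxes is a rook strip if it has at most one box in each row and in
each column. -/
def IsRookStripCells (s : Finset (ℕ × ℕ)) : Prop :=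
  (∀ i, (s.filter fun c => c.1 = i).card ≤ 1) ∧ (∀ j, (s.filter fun c => c.2 = j).card ≤ 1)

/-- The rectangular Young diagram with `p` rows and `q` columns. -/
def rect (p q : ℕ) : YoungDiagram :=
  ⟨Finset.range p ×ˢ Finset.range q, by
    intro a b hba ha
    simp only [Finset.coe_product, Set.mem_prod, Finset.mem_coe, Finset.mem_range] at ha ⊢
    exact ⟨lt_of_le_of_lt hba.1 ha.1, lt_of_le_of_lt hba.2 ha.2⟩⟩

theorem List.suffix_append_cases {α : Type*} {s u v : List α} (h : s <:+ u ++ v) :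
    s <:+ v ∨ ∃ s', s' <:+ u ∧ s = s' ++ v := by
  obtain ⟨t, ht⟩ := h
  rcases List.append_eq_append_iff.1 ht with ⟨a, rfl, rfl⟩ | ⟨b, rfl, rfl⟩
  · exact Or.inr ⟨a, ⟨t, rfl⟩, rfl⟩
  · exact Or.inl ⟨b, rfl⟩

/-- A suffix `s` of a block `f a` extends to a suffix of the concatenation of all blocks, the new
letters coming from blocks `f b` with `b` after `a`. -/
theorem List.exists_suffix_flatMap {α β : Type*} {R : α → α → Prop} {L : List α}
    (hL : L.Pairwise R) {f : α → List β} {a : α} (ha : a ∈ L) {s : List β} (hs : s <:+ f a) :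
    ∃ s', s' <:+ L.flatMap f ∧ (∀ y ∈ s, y ∈ s') ∧
      ∀ y ∈ s', y ∈ s ∨ ∃ b ∈ L, R a b ∧ y ∈ f b := by
  obtain ⟨l₁, l₂, rfl⟩ := List.append_of_mem ha
  obtain ⟨t, ht⟩ := hs
  refine ⟨s ++ l₂.flatMap f, ⟨l₁.flatMap f ++ t, by simp [← ht]⟩, fun y hy => by simp [hy], ?_⟩
  intro y hy
  rcases List.mem_append.1 hy with hy | hy
  · exact Or.inl hy
  · obtain ⟨b, hb, hyb⟩ := List.mem_flatMap.1 hy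
    have := (List.pairwise_append.1 hL).2.1
    exact Or.inr ⟨b, by simp [hb], (List.pairwise_cons.1 this).1 b hb, hyb⟩

theorem IsPartialRLW.append {a b : ℕ} {u v : List ℕ} (hu : IsPartialRLW a b u)
    (hv : IsPartialRLW a b v) : IsPartialRLW a b (u ++ v) := by
  intro s hs t hat htb
  rcases List.suffix_append_cases hs with h | ⟨s', h, rfl⟩
  · exact hv s h t hat htb
  · simpa using add_le_add (hu s' h t hat htb) (hv v List.suffix_rfl t hat htb)

theorem IsPartialRLW.flatMap {α : Type*} {a b : ℕ} {L : List α} {f : α → List ℕ}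
    (h : ∀ x ∈ L, IsPartialRLW a b (f x)) : IsPartialRLW a b (L.flatMap f) := by
  induction L with
  | nil =>
    intro s hs t _ _
    simp [List.suffix_nil.1 hs]
  | cons x L ih =>
    rw [List.flatMap_cons]
    exact (h x (by simp)).append (ih fun y hy => h y (by simp [hy]))

namespace SVT

variable {cells : Finset (ℕ × ℕ)}

theorem mem_cells_of_mem_entry (T : SVT cells) {c : ℕ × ℕ} {x : ℕ} (h : x ∈ T.entry c) :
    c ∈ cells := by
  by_contra hc
  simp [T.eq_empty_of_not_mem c hc] at h

theorem entry_injective : Function.Injective (SVT.entry (cells := cells)) := by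
  rintro ⟨f, _, _, _, _⟩ ⟨g, _, _, _, _⟩ h
  cases h
  rfl

theorem lt_of_mem_cells {c : ℕ × ℕ} (h : c ∈ cells) :
    c.1 < (cells.sup fun c => max c.1 c.2) + 1 ∧ c.2 < (cells.sup fun c => max c.1 c.2) + 1 := by
  have := Finset.le_sup (f := fun c : ℕ × ℕ => max c.1 c.2) h
  simp only [sup_le_iff] at this
  omega

theorem count_sort (s : Finset ℕ) (x : ℕ) :
    (s.sort (· ≤ ·)).count x = if x ∈ s then 1 else 0 := by
  rw [List.Nodup.count (Finset.sort_nodup _ _)]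
  simp

theorem count_word (T : SVT cells) (x : ℕ) :
    T.word.count x = (cells.filter fun c => x ∈ T.entry c).card := by
  set N := (cells.sup fun c => max c.1 c.2) + 1 with hN
  have h1 : T.word.count x =
      ∑ j ∈ Finset.range N, ∑ i ∈ Finset.range N, if x ∈ T.entry (i, j) then 1 else 0 := by
    simp only [word, List.count_flatMap, Function.comp_def, count_sort, List.map_reverse,
      List.sum_reverse, ← hN]
    rfl
  rw [h1, Finset.sum_comm, ← Finset.sum_product', ← Finset.card_filter]
  congr 1
  ext c
  simp only [Finset.mem_filter, Finset.mem_product, Finset.mem_range]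
  exact ⟨fun h => ⟨T.mem_cells_of_mem_entry h.2, h.2⟩, fun h => ⟨lt_of_mem_cells h.1, h.2⟩⟩

theorem exists_suffix_word (T : SVT cells) {i j x : ℕ} (hx : x ∈ T.entry (i, j)) :
    ∃ s, s <:+ T.word ∧ x ∈ s ∧ ∀ y ∈ s, ∃ i' j', y ∈ T.entry (i', j') ∧
      (j < j' ∨ j' = j ∧ i' < i ∨ j' = j ∧ i' = i ∧ x ≤ y) := by
  have hc := lt_of_mem_cells (T.mem_cells_of_mem_entry hx)
  set N := (cells.sup fun c => max c.1 c.2) + 1 with hN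
  have hsort : ∃ s, s <:+ (T.entry (i, j)).sort (· ≤ ·) ∧ x ∈ s ∧ ∀ y ∈ s, x ≤ y := by
    obtain ⟨l₁, l₂, h⟩ := List.append_of_mem ((Finset.mem_sort (· ≤ ·)).2 hx)
    have hp := Finset.pairwise_sort (T.entry (i, j)) (· ≤ ·)
    rw [h] at hp ⊢
    refine ⟨x :: l₂, ⟨l₁, rfl⟩, by simp, ?_⟩
    have := (List.pairwise_cons.1 (List.pairwise_append.1 hp).2.1).1
    simpa using this
  obtain ⟨s₀, hs₀, hx₀, hle⟩ := hsort
  have hrev : (List.range N).reverse.Pairwise (fun a b => b < a) := by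
    rw [List.pairwise_reverse]
    exact List.pairwise_lt_range
  obtain ⟨s₁, hs₁, hsub₁, hmem₁⟩ := List.exists_suffix_flatMap hrev
    (f := fun i' => (T.entry (i', j)).sort (· ≤ ·)) (a := i)
    (by simpa using hc.1) hs₀
  obtain ⟨s₂, hs₂, hsub₂, hmem₂⟩ := List.exists_suffix_flatMap
    (List.pairwise_lt_range (n := N))
    (f := fun j' => (List.range N).reverse.flatMap fun i' => (T.entry (i', j')).sort (· ≤ ·))
    (a := j) (by simpa using hc.2) hs₁
  have hword : ∀ y ∈ s₀, y ∈ T.entry (i, j) := fun y hy => by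
    simpa using hs₀.subset hy
  refine ⟨s₂, hs₂, hsub₂ _ (hsub₁ _ hx₀), fun y hy => ?_⟩
  rcases hmem₂ y hy with hy | ⟨j', _, hj', hy⟩
  · rcases hmem₁ y hy with hy | ⟨i', _, hi', hy⟩
    · exact ⟨i, j, hword y hy, by simp [hle y hy]⟩
    · exact ⟨i', j, by simpa using hy, by simp [hi']⟩
  · obtain ⟨i', _, hy⟩ := List.mem_flatMap.1 hy
    exact ⟨i', j', by simpa using hy, by simp [hj']⟩

/-- If in the first rows every entry below `p` equals its row index, and the entry `t + 1` in row
`t + 1` has a `t` above it, then the word satisfies the lattice condition on `[0, p)`. -/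
theorem isPartialRLW_word (T : SVT cells) {p : ℕ}
    (hrow : ∀ i j, ∀ x ∈ T.entry (i, j), x < p → x = i)
    (hup : ∀ i j, i + 1 < p → i + 1 ∈ T.entry (i + 1, j) → i ∈ T.entry (i, j)) :
    IsPartialRLW 0 p T.word := by
  refine IsPartialRLW.flatMap fun j _ => ?_
  generalize (cells.sup fun c => max c.1 c.2) + 1 = N
  induction N with
  | zero =>
    intro s hs t _ _
    have : s = [] := by simpa using hs
    simp [this]
  | succ n ih =>
    rw [List.range_succ, List.reverse_append, List.reverse_singleton, List.singleton_append,
      List.flatMap_cons]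
    set C := (List.range n).reverse.flatMap fun i => (T.entry (i, j)).sort (· ≤ ·) with hC
    intro s hs t ht htp
    rcases List.suffix_append_cases hs with h | ⟨s', h, rfl⟩
    · exact ih s h t ht htp
    rw [List.count_append, List.count_append]
    have hCt := ih C List.suffix_rfl t ht htp
    have hcount := h.sublist.count_le (t + 1)
    rw [count_sort] at hcount
    split_ifs at hcount with hmem
    · obtain rfl := hrow n j _ hmem htp
      have h0 : C.count (t + 1) = 0 := by
        refine List.count_eq_zero_of_not_mem fun hm => ?_
        simp only [hC, List.mem_flatMap, List.mem_reverse, List.mem_range, Finset.mem_sort] at hm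
        obtain ⟨i, hi, hm⟩ := hm
        have := hrow i j _ hm htp
        omega
      have h1 : 0 < C.count t := by
        refine List.count_pos_iff.2 ?_
        simp only [hC, List.mem_flatMap, List.mem_reverse, List.mem_range, Finset.mem_sort]
        exact ⟨t, by omega, hup t j htp hmem⟩
      omega
    · omega

variable {lam : YoungDiagram}

theorem le_of_row (T : SVT lam.cells) {i j j' a b : ℕ} (hj : j < j') (ha : a ∈ T.entry (i, j))
    (hb : b ∈ T.entry (i, j')) : a ≤ b := by
  induction j', hj using Nat.le_induction generalizing b with
  | base =>
    exact T.row_weak _ _ (T.mem_cells_of_mem_entry ha) (T.mem_cells_of_mem_entry hb) _ ha _ hb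
  | succ n _ ih =>
    have hc := T.mem_cells_of_mem_entry hb
    have hc' : (i, n) ∈ lam.cells := lam.up_left_mem le_rfl n.le_succ hc
    obtain ⟨y, hy⟩ := T.nonempty_of_mem _ hc'
    exact (ih hy).trans (T.row_weak _ _ hc' hc _ hy _ hb)

theorem lt_of_col (T : SVT lam.cells) {i i' j a b : ℕ} (hi : i < i') (ha : a ∈ T.entry (i, j))
    (hb : b ∈ T.entry (i', j)) : a < b := by
  induction i', hi using Nat.le_induction generalizing b with
  | base =>
    exact T.col_strict _ _ (T.mem_cells_of_mem_entry ha) (T.mem_cells_of_mem_entry hb) _ ha _ hb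
  | succ n _ ih =>
    have hc := T.mem_cells_of_mem_entry hb
    have hc' : (n, j) ∈ lam.cells := lam.up_left_mem n.le_succ le_rfl hc
    obtain ⟨y, hy⟩ := T.nonempty_of_mem _ hc'
    exact (ih hy).trans (T.col_strict _ _ hc' hc _ hy _ hb)

theorem le_of_lt_col (T : SVT lam.cells) {i i' j j' a b : ℕ} (hi : i ≤ i') (hj : j < j')
    (ha : a ∈ T.entry (i, j)) (hb : b ∈ T.entry (i', j')) : a ≤ b := by
  rcases hi.eq_or_lt with rfl | hi
  · exact T.le_of_row hj ha hb
  · obtain ⟨y, hy⟩ := T.nonempty_of_mem (i, j')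
      (lam.up_left_mem hi.le le_rfl (T.mem_cells_of_mem_entry hb))
    exact (T.le_of_row hj ha hy).trans (T.lt_of_col hi hy hb).le

/-- In a straight shape, the lattice condition forces the entries below `p` to be superstandard. -/
theorem eq_row_of_isPartialRLW (T : SVT lam.cells) {p : ℕ} (hT : IsPartialRLW 0 p T.word) :
    ∀ i j, ∀ x ∈ T.entry (i, j), x < p → x = i := by
  intro i
  induction i using Nat.strong_induction_on with
  | _ i ih =>
  intro j x hx hxp
  refine le_antisymm ?_ ?_
  · by_contra! hlt
    obtain ⟨s, hs, hxs, hmem⟩ := T.exists_suffix_word hx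
    have hcount := hT s hs (x - 1) (Nat.zero_le _) (by omega)
    have hpos : 0 < s.count (x - 1 + 1) := by
      rw [Nat.sub_add_cancel (by omega)]
      exact List.count_pos_iff.2 hxs
    obtain ⟨i', j', hy, hpos'⟩ := hmem (x - 1) (List.count_pos_iff.1 (by omega))
    by_cases hi' : i' < i
    · have := ih i' hi' j' _ hy (by omega)
      omega
    · rcases hpos' with h | h | h
      · have := T.le_of_lt_col (by omega) h hx hy
        omega
      · omega
      · omega
  · rcases i with _ | i
    · exact Nat.zero_le _
    · obtain ⟨y, hy⟩ := T.nonempty_of_mem (i, j)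
        (lam.up_left_mem i.le_succ le_rfl (T.mem_cells_of_mem_entry hx))
      have hyx := T.lt_of_col i.lt_succ_self hy hx
      have := ih i i.lt_succ_self j y hy (by omega)
      omega

end SVT

namespace YoungDiagram

theorem lt_colLen_zero {mu : YoungDiagram} {i j : ℕ} (h : j < mu.rowLen i) : i < mu.colLen 0 :=
  mem_iff_lt_colLen.1 (mu.up_left_mem le_rfl (Nat.zero_le j) (mem_iff_lt_rowLen.2 h))

theorem le_iff_rowLen_le {mu lam : YoungDiagram} :
    mu ≤ lam ↔ ∀ i, mu.rowLen i ≤ lam.rowLen i := by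
  constructor
  · intro h i
    by_contra! hlt
    exact lt_irrefl _ (mem_iff_lt_rowLen.1 (h (mem_iff_lt_rowLen.2 hlt)))
  · rintro h ⟨i, j⟩ hc
    exact mem_iff_lt_rowLen.2 ((mem_iff_lt_rowLen.1 hc).trans_le (h i))

end YoungDiagram

open YoungDiagram in
theorem isHorizontalStrip_iff_rowLen {mu lam : YoungDiagram} :
    IsHorizontalStrip mu lam ↔ ∀ i, lam.rowLen (i + 1) ≤ mu.rowLen i := by
  constructor
  · intro h i
    by_contra! hlt
    have h1 := mem_iff_lt_colLen.1 (mem_iff_lt_rowLen.2 hlt)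
    have h2 := h (mu.rowLen i)
    exact lt_irrefl _ (mem_iff_lt_rowLen.1 (mem_iff_lt_colLen.2 (show i < mu.colLen _ by omega)))
  · intro h j
    by_contra! hlt
    have h1 := mem_iff_lt_rowLen.1 (mem_iff_lt_colLen.2 hlt)
    exact lt_irrefl _ (mem_iff_lt_colLen.1 (mem_iff_lt_rowLen.2 (h1.trans_le (h _))))

theorem Finset.mem_iff_lt_card {s : Finset ℕ} (hs : ∀ a ∈ s, ∀ b < a, b ∈ s) {a : ℕ} :
    a ∈ s ↔ a < s.card := by
  have hsub : s ⊆ Finset.range s.card := fun a ha => by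
    have : Finset.range (a + 1) ⊆ s := fun b hb => by
      rcases (Nat.lt_succ_iff.1 (Finset.mem_range.1 hb)).eq_or_lt with rfl | hlt
      · exact ha
      · exact hs a ha b hlt
    simpa using Finset.card_le_card this
  conv_lhs => rw [Finset.eq_of_subset_of_card_le hsub (by simp)]
  exact Finset.mem_range

/-- The rows of `mu` that are longer than the next row of `lam`. -/
def pieriRows (lam mu : YoungDiagram) : Finset ℕ :=
  (Finset.range (mu.colLen 0)).filter fun i => lam.rowLen (i + 1) < mu.rowLen i

/-- The filling of `lam` with `i` in the boxes of row `i` of `mu`, with `p = ℓ(mu)` in the boxes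
outside `mu`, and with an additional `p` in the last box of row `i` of `mu` for `i ∈ S`. -/
def pieriEntry (lam mu : YoungDiagram) (S : Finset ℕ) (c : ℕ × ℕ) : Finset ℕ :=
  (Finset.range (mu.colLen 0 + 1)).filter fun x => c ∈ lam.cells ∧
    (x = c.1 ∧ c.2 < mu.rowLen c.1 ∨
      x = mu.colLen 0 ∧ (mu.rowLen c.1 ≤ c.2 ∨ c.1 ∈ S ∧ c.2 + 1 = mu.rowLen c.1))

/-- The tableaux counted by `dCoeff mu (rect 1 k) lam`. -/
def IsPieri (mu : YoungDiagram) (k : ℕ) {lam : YoungDiagram} (T : SVT lam.cells) : Prop :=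
  IsPartialRLW 0 (mu.colLen 0) T.word ∧
    ∀ i, T.word.count i =
      if i < mu.colLen 0 then mu.rowLen i else if i = mu.colLen 0 then k else 0

section

variable {lam mu : YoungDiagram} {k : ℕ} {S : Finset ℕ}

theorem mem_pieriEntry {i j x : ℕ} : x ∈ pieriEntry lam mu S (i, j) ↔ (i, j) ∈ lam.cells ∧
    (x = i ∧ j < mu.rowLen i ∨
      x = mu.colLen 0 ∧ (mu.rowLen i ≤ j ∨ i ∈ S ∧ j + 1 = mu.rowLen i)) := by
  simp only [pieriEntry, Finset.mem_filter, Finset.mem_range, and_iff_right_iff_imp]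
  rintro ⟨-, ⟨rfl, h⟩ | ⟨rfl, -⟩⟩
  · have := YoungDiagram.lt_colLen_zero h
    omega
  · omega

theorem lt_rowLen_of_mem_pieriRows {i : ℕ} (h : i ∈ pieriRows lam mu) :
    lam.rowLen (i + 1) < mu.rowLen i :=
  (Finset.mem_filter.1 h).2

/-- The tableau with entries `pieriEntry lam mu S`. -/
def pieriTableau (hstrip : IsHorizontalStrip mu lam) (hS : S ⊆ pieriRows lam mu) :
    SVT lam.cells where
  entry := pieriEntry lam mu S
  nonempty_of_mem := by
    rintro ⟨i, j⟩ hc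
    by_cases h : j < mu.rowLen i
    · exact ⟨i, mem_pieriEntry.2 ⟨hc, Or.inl ⟨rfl, h⟩⟩⟩
    · exact ⟨mu.colLen 0, mem_pieriEntry.2 ⟨hc, Or.inr ⟨rfl, Or.inl (not_lt.1 h)⟩⟩⟩
  eq_empty_of_not_mem := by
    rintro ⟨i, j⟩ hc
    exact Finset.eq_empty_of_forall_notMem fun x hx => hc (mem_pieriEntry.1 hx).1
  row_weak := by
    intro i j _ _ a ha b hb
    rcases mem_pieriEntry.1 ha with ⟨-, ⟨rfl, h⟩ | ⟨rfl, h⟩⟩ <;>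
      rcases mem_pieriEntry.1 hb with ⟨-, ⟨rfl, h'⟩ | ⟨rfl, h'⟩⟩
    · rfl
    · exact (YoungDiagram.lt_colLen_zero h).le
    · omega
    · rfl
  col_strict := by
    intro i j _ hc a ha b hb
    have hj : j < lam.rowLen (i + 1) := YoungDiagram.mem_iff_lt_rowLen.1 hc
    have hj' := isHorizontalStrip_iff_rowLen.1 hstrip i
    rcases mem_pieriEntry.1 ha with ⟨-, ⟨rfl, h⟩ | ⟨rfl, h | ⟨h, h1⟩⟩⟩
    · rcases mem_pieriEntry.1 hb with ⟨-, ⟨rfl, h'⟩ | ⟨rfl, h'⟩⟩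
      · exact Nat.lt_succ_self _
      · exact YoungDiagram.lt_colLen_zero h
    · omega
    · have := lt_rowLen_of_mem_pieriRows (hS h)
      omega

theorem card_filter_mem_pieriEntry (hle : mu ≤ lam) (hS : S ⊆ pieriRows lam mu) (x : ℕ) :
    (lam.cells.filter fun c => x ∈ pieriEntry lam mu S c).card =
      if x < mu.colLen 0 then mu.rowLen x else
        if x = mu.colLen 0 then lam.card - mu.card + S.card else 0 := by
  have hle' := YoungDiagram.le_iff_rowLen_le.1 hle
  split_ifs with h1 h2
  · have : (lam.cells.filter fun c => x ∈ pieriEntry lam mu S c) =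
        (Finset.range (mu.rowLen x)).image fun j => (x, j) := by
      ext ⟨i, j⟩
      simp only [Finset.mem_filter, mem_pieriEntry, Finset.mem_image, Finset.mem_range,
        Prod.mk.injEq]
      constructor
      · rintro ⟨-, -, ⟨rfl, h⟩ | ⟨rfl, h⟩⟩
        · exact ⟨j, h, rfl, rfl⟩
        · omega
      · rintro ⟨j, h, rfl, rfl⟩
        have : (x, j) ∈ lam.cells := hle (YoungDiagram.mem_iff_lt_rowLen.2 h)
        exact ⟨this, this, Or.inl ⟨rfl, h⟩⟩
    rw [this, Finset.card_image_of_injective _ (Prod.mk_right_injective x), Finset.card_range]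
  · subst h2
    have hpos : ∀ i ∈ S, 0 < mu.rowLen i := fun i hi =>
      (Nat.zero_le _).trans_lt (lt_rowLen_of_mem_pieriRows (hS hi))
    have : (lam.cells.filter fun c => mu.colLen 0 ∈ pieriEntry lam mu S c) =
        (lam.cells \ mu.cells) ∪ S.image fun i => (i, mu.rowLen i - 1) := by
      ext ⟨i, j⟩
      simp only [Finset.mem_filter, mem_pieriEntry, Finset.mem_image, Finset.mem_union,
        Finset.mem_sdiff, Prod.mk.injEq, YoungDiagram.mem_cells, YoungDiagram.mem_iff_lt_rowLen]
      constructor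
      · rintro ⟨hc, -, ⟨rfl, h⟩ | ⟨-, h | ⟨h, h'⟩⟩⟩
        · exact absurd (YoungDiagram.lt_colLen_zero h) (lt_irrefl _)
        · exact Or.inl ⟨hc, not_lt.2 h⟩
        · exact Or.inr ⟨i, h, rfl, by omega⟩
      · rintro (⟨hc, h⟩ | ⟨i, h, rfl, rfl⟩)
        · exact ⟨hc, hc, Or.inr ⟨trivial, Or.inl (not_lt.1 h)⟩⟩
        · have h1 := hpos i h
          have h2 := hle' i
          exact ⟨by omega, by omega, Or.inr ⟨trivial, Or.inr ⟨h, by omega⟩⟩⟩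
    rw [this, Finset.card_union_of_disjoint, Finset.card_sdiff_of_subset
      (YoungDiagram.cells_subset_iff.2 hle), Finset.card_image_of_injective _
      fun a b h => (Prod.mk.inj h).1]
    rw [Finset.disjoint_left]
    rintro ⟨i, j⟩ hc hc'
    simp only [Finset.mem_image, Prod.mk.injEq, Finset.mem_sdiff, YoungDiagram.mem_cells,
      YoungDiagram.mem_iff_lt_rowLen] at hc hc'
    obtain ⟨i, h, rfl, rfl⟩ := hc'
    have := hpos i h
    omega
  · rw [Finset.card_eq_zero, Finset.filter_eq_empty_iff]
    rintro ⟨i, j⟩ - h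
    rcases mem_pieriEntry.1 h with ⟨-, ⟨rfl, h⟩ | ⟨h, -⟩⟩
    · exact h1 (YoungDiagram.lt_colLen_zero h)
    · exact h2 h

theorem isPieri_pieriTableau (hle : mu ≤ lam) (hstrip : IsHorizontalStrip mu lam)
    (hS : S ⊆ pieriRows lam mu) (hcard : lam.card + S.card = mu.card + k) :
    IsPieri mu k (pieriTableau hstrip hS) := by
  refine ⟨SVT.isPartialRLW_word _ ?_ ?_, fun i => ?_⟩
  · intro i j x hx hxp
    rcases mem_pieriEntry.1 hx with ⟨-, ⟨rfl, -⟩ | ⟨rfl, -⟩⟩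
    · rfl
    · exact absurd hxp (lt_irrefl _)
  · intro i j hip hx
    rcases mem_pieriEntry.1 hx with ⟨hc, ⟨-, h⟩ | ⟨h, -⟩⟩
    · exact mem_pieriEntry.2 ⟨lam.up_left_mem i.le_succ le_rfl hc,
        Or.inl ⟨rfl, h.trans_le (mu.rowLen_anti _ _ i.le_succ)⟩⟩
    · omega
  · have h1 : mu.card ≤ lam.card := Finset.card_le_card (YoungDiagram.cells_subset_iff.2 hle)
    have h2 : lam.card - mu.card + S.card = k := by omega
    rw [SVT.count_word, ← h2]
    exact card_filter_mem_pieriEntry hle hS i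

theorem IsPieri.le_colLen {T : SVT lam.cells} (hT : IsPieri mu k T) {c : ℕ × ℕ} {x : ℕ}
    (hx : x ∈ T.entry c) : x ≤ mu.colLen 0 := by
  by_contra! hlt
  have h := hT.2 x
  rw [if_neg (by omega), if_neg (by omega), SVT.count_word, Finset.card_eq_zero,
    Finset.filter_eq_empty_iff] at h
  exact h (T.mem_cells_of_mem_entry hx) hx

theorem IsPieri.mem_entry_row_iff {T : SVT lam.cells} (hT : IsPieri mu k T) {i j : ℕ}
    (hi : i < mu.colLen 0) : i ∈ T.entry (i, j) ↔ j < mu.rowLen i := by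
  have hrow := T.eq_row_of_isPartialRLW hT.1
  set A := lam.cells.filter fun c => i ∈ T.entry c with hA
  have hcard : (A.image Prod.snd).card = mu.rowLen i := by
    rw [Finset.card_image_of_injOn, hA, ← SVT.count_word, hT.2 i, if_pos hi]
    rintro ⟨a, b⟩ h ⟨a', b'⟩ h' hb
    simp only [hA, Finset.coe_filter, Set.mem_ofPred_eq] at h h' hb
    rw [← hrow _ _ _ h.2 hi, ← hrow _ _ _ h'.2 hi, hb]
  have hmem : ∀ j, j ∈ A.image Prod.snd ↔ i ∈ T.entry (i, j) := by
    intro j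
    simp only [hA, Finset.mem_image, Finset.mem_filter, Prod.exists, exists_eq_right]
    constructor
    · rintro ⟨a, -, h⟩
      have := hrow _ _ _ h hi
      rwa [← this] at h
    · exact fun h => ⟨i, T.mem_cells_of_mem_entry h, h⟩
  rw [← hmem, Finset.mem_iff_lt_card, hcard]
  intro a ha b hb
  rw [hmem] at ha ⊢
  obtain ⟨y, hy⟩ := T.nonempty_of_mem (i, b)
    (lam.up_left_mem le_rfl hb.le (T.mem_cells_of_mem_entry ha))
  have hyi := hrow _ _ _ hy ((T.le_of_row hb hy ha).trans_lt hi)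
  rwa [hyi] at hy

theorem IsPieri.mem_entry_iff {T : SVT lam.cells} (hT : IsPieri mu k T) {i j x : ℕ} :
    x ∈ T.entry (i, j) ↔
      x = i ∧ j < mu.rowLen i ∨ x = mu.colLen 0 ∧ mu.colLen 0 ∈ T.entry (i, j) := by
  constructor
  · intro hx
    rcases (hT.le_colLen hx).eq_or_lt with rfl | hlt
    · exact Or.inr ⟨rfl, hx⟩
    · obtain rfl := T.eq_row_of_isPartialRLW hT.1 _ _ _ hx hlt
      exact Or.inl ⟨rfl, (hT.mem_entry_row_iff hlt).1 hx⟩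
  · rintro (⟨rfl, h⟩ | ⟨rfl, h⟩)
    · exact (hT.mem_entry_row_iff (YoungDiagram.lt_colLen_zero h)).2 h
    · exact h

theorem IsPieri.colLen_mem_entry {T : SVT lam.cells} (hT : IsPieri mu k T) {i j : ℕ}
    (hc : (i, j) ∈ lam.cells) (hj : mu.rowLen i ≤ j) : mu.colLen 0 ∈ T.entry (i, j) := by
  obtain ⟨y, hy⟩ := T.nonempty_of_mem _ hc
  rcases hT.mem_entry_iff.1 hy with ⟨-, h⟩ | ⟨-, h⟩
  · omega
  · exact h

theorem IsPieri.notMem_of_colLen_mem_entry {T : SVT lam.cells} (hT : IsPieri mu k T) {i j : ℕ}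
    (h : mu.colLen 0 ∈ T.entry (i, j)) : (i + 1, j) ∉ lam.cells := by
  intro hc
  obtain ⟨y, hy⟩ := T.nonempty_of_mem _ hc
  exact absurd (T.lt_of_col i.lt_succ_self h hy) (not_lt.2 (hT.le_colLen hy))

theorem IsPieri.le {T : SVT lam.cells} (hT : IsPieri mu k T) : mu ≤ lam := by
  rintro ⟨i, j⟩ h
  exact T.mem_cells_of_mem_entry
    (hT.mem_entry_iff.2 (Or.inl ⟨rfl, YoungDiagram.mem_iff_lt_rowLen.1 h⟩))

theorem IsPieri.isHorizontalStrip {T : SVT lam.cells} (hT : IsPieri mu k T) :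
    IsHorizontalStrip mu lam := by
  refine isHorizontalStrip_iff_rowLen.2 fun i => ?_
  by_contra! hlt
  have hc : (i + 1, mu.rowLen i) ∈ lam.cells := YoungDiagram.mem_iff_lt_rowLen.2 hlt
  exact hT.notMem_of_colLen_mem_entry
    (hT.colLen_mem_entry (lam.up_left_mem i.le_succ le_rfl hc) le_rfl) hc

theorem IsPieri.exists_entry_eq {T : SVT lam.cells} (hT : IsPieri mu k T) :
    ∃ S ⊆ pieriRows lam mu, lam.card + S.card = mu.card + k ∧ T.entry = pieriEntry lam mu S := by
  set S := (pieriRows lam mu).filter fun i => mu.colLen 0 ∈ T.entry (i, mu.rowLen i - 1) with hS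
  have hsub : S ⊆ pieriRows lam mu := Finset.filter_subset _ _
  have hentry : T.entry = pieriEntry lam mu S := by
    funext ⟨i, j⟩
    ext x
    rw [mem_pieriEntry, hT.mem_entry_iff]
    constructor
    · rintro (⟨rfl, h⟩ | ⟨rfl, h⟩)
      · exact ⟨hT.le (YoungDiagram.mem_iff_lt_rowLen.2 h), Or.inl ⟨rfl, h⟩⟩
      · refine ⟨T.mem_cells_of_mem_entry h, Or.inr ⟨rfl, ?_⟩⟩
        by_cases hj : j < mu.rowLen i
        · have hi := YoungDiagram.lt_colLen_zero hj
          have hj' : j + 1 = mu.rowLen i := by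
            by_contra hne
            have hmem := (hT.mem_entry_row_iff hi).2 (show j + 1 < mu.rowLen i by omega)
            exact absurd (T.le_of_row j.lt_succ_self h hmem) (not_le.2 hi)
          have hnot := hT.notMem_of_colLen_mem_entry h
          rw [YoungDiagram.mem_cells, YoungDiagram.mem_iff_lt_rowLen] at hnot
          refine Or.inr ⟨?_, hj'⟩
          rw [hS, Finset.mem_filter, pieriRows, Finset.mem_filter, Finset.mem_range, ← hj']
          exact ⟨⟨hi, by omega⟩, h⟩
        · exact Or.inl (not_lt.1 hj)
    · rintro ⟨hc, h | ⟨rfl, h | ⟨h, hj⟩⟩⟩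
      · exact Or.inl h
      · exact Or.inr ⟨rfl, hT.colLen_mem_entry hc h⟩
      · have := (Finset.mem_filter.1 h).2
        rw [← hj] at this
        exact Or.inr ⟨rfl, this⟩
  refine ⟨S, hsub, ?_, hentry⟩
  have hk := hT.2 (mu.colLen 0)
  rw [SVT.count_word, hentry, card_filter_mem_pieriEntry hT.le hsub, if_neg (lt_irrefl _),
    if_pos rfl, if_neg (lt_irrefl _), if_pos rfl] at hk
  have : mu.card ≤ lam.card := Finset.card_le_card (YoungDiagram.cells_subset_iff.2 hT.le)
  omega

theorem subset_of_pieriEntry_eq (hle : mu ≤ lam) {S' : Finset ℕ} (hS : S ⊆ pieriRows lam mu)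
    (h : pieriEntry lam mu S = pieriEntry lam mu S') : S ⊆ S' := by
  intro i hi
  have hpos := lt_rowLen_of_mem_pieriRows (hS hi)
  have hp : i < mu.colLen 0 := YoungDiagram.lt_colLen_zero hpos
  have hmem : mu.colLen 0 ∈ pieriEntry lam mu S (i, mu.rowLen i - 1) :=
    mem_pieriEntry.2 ⟨hle (YoungDiagram.mem_iff_lt_rowLen.2 (by omega)),
      Or.inr ⟨rfl, Or.inr ⟨hi, by omega⟩⟩⟩
  rw [h] at hmem
  rcases mem_pieriEntry.1 hmem with ⟨-, ⟨h, -⟩ | ⟨-, h | ⟨h, -⟩⟩⟩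
  · omega
  · omega
  · exact h

theorem card_isPieri (hle : mu ≤ lam) (hstrip : IsHorizontalStrip mu lam)
    (hk : lam.card ≤ mu.card + k) :
    Nat.card {T : SVT lam.cells // IsPieri mu k T} =
      (pieriRows lam mu).card.choose (mu.card + k - lam.card) := by
  rw [← Finset.card_powersetCard, ← Nat.card_eq_finsetCard]
  have hmem : ∀ S ∈ (pieriRows lam mu).powersetCard (mu.card + k - lam.card),
      S ⊆ pieriRows lam mu ∧ lam.card + S.card = mu.card + k := fun S hS => by
    rw [Finset.mem_powersetCard] at hS
    exact ⟨hS.1, by omega⟩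
  refine (Nat.card_eq_of_bijective (fun S => ⟨pieriTableau hstrip (hmem S.1 S.2).1,
    isPieri_pieriTableau hle hstrip (hmem S.1 S.2).1 (hmem S.1 S.2).2⟩) ⟨?_, ?_⟩).symm
  · rintro ⟨S, hS⟩ ⟨S', hS'⟩ h
    have h' : pieriEntry lam mu S = pieriEntry lam mu S' :=
      congrArg (fun T => SVT.entry (Subtype.val T)) h
    exact Subtype.ext (Finset.Subset.antisymm (subset_of_pieriEntry_eq hle (hmem S hS).1 h')
      (subset_of_pieriEntry_eq hle (hmem S' hS').1 h'.symm))
  · rintro ⟨T, hT⟩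
    obtain ⟨S, hS, hcard, h⟩ := hT.exists_entry_eq
    exact ⟨⟨S, Finset.mem_powersetCard.2 ⟨hS, by omega⟩⟩,
      Subtype.ext (SVT.entry_injective h.symm)⟩

theorem mem_rect {p q : ℕ} {c : ℕ × ℕ} : c ∈ rect p q ↔ c.1 < p ∧ c.2 < q := by
  rw [← YoungDiagram.mem_cells]
  simp [rect]

theorem colLen_rect_one (hk : 1 ≤ k) : (rect 1 k).colLen 0 = 1 := by
  have h : ∀ i, i < (rect 1 k).colLen 0 ↔ i < 1 := fun i => by
    rw [← YoungDiagram.mem_iff_lt_colLen, mem_rect]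
    omega
  have h0 := h 0
  have h1 := h 1
  omega

theorem rowLen_rect_one (i : ℕ) : (rect 1 k).rowLen i = if i = 0 then k else 0 := by
  have h : ∀ j, j < (rect 1 k).rowLen i ↔ i = 0 ∧ j < k := fun j => by
    rw [← YoungDiagram.mem_iff_lt_rowLen, mem_rect]
    omega
  split_ifs with hi
  · have h0 := h k
    have h1 := h ((rect 1 k).rowLen i)
    omega
  · have h0 := h 0
    omega

theorem dCoeff_rect_one (hk : 1 ≤ k) : dCoeff mu (rect 1 k) lam =
    (-1) ^ (mu.card + k - lam.card) * (Nat.card {T : SVT lam.cells // IsPieri mu k T} : ℤ) := by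
  have hcard : (rect 1 k).card = k := by
    simp [YoungDiagram.card, rect]
  rw [dCoeff, hcard]
  congr 3
  refine congrArg Subtype (funext fun T => propext ?_)
  simp only [IsPieri, colLen_rect_one hk, rowLen_rect_one]
  refine and_congr_right fun _ => ⟨fun h i => ?_, fun h => ⟨fun s _ t _ _ => by omega, fun i => ?_⟩⟩
  · rw [h.2 i]
    split_ifs <;> first | rfl | omega
  · rw [h i]
    split_ifs <;> first | rfl | omega

end

/-- **Pieri rule for the coproduct coefficients** (Corollary 7.1): for
partitions `μ ⊆ λ` with `λ/μ` a horizontal strip and `k ≥ 1`,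
`d^λ_{μ,(k)} = (-1)^{k-|λ/μ|} C(r, k-|λ/μ|)` where `r` is the number of
nonempty rows of `μ/λ̄` (`λ̄` being `λ` with its top row removed), the binomial
coefficient being zero when `k < |λ/μ|` or `k - |λ/μ| > r`; and
`d^λ_{μ,(k)} = 0` if `μ ⊄ λ` or `λ/μ` is not a horizontal strip. -/
theorem dCoeff_pieri (lam mu : YoungDiagram) (k : ℕ) (hk : 1 ≤ k) :
    (mu ≤ lam → IsHorizontalStrip mu lam → lam.card ≤ mu.card + k →
      dCoeff mu (rect 1 k) lam =
        (-1 : ℤ) ^ (mu.card + k - lam.card) *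
          (Nat.choose
            (((Finset.range (mu.colLen 0)).filter fun i =>
              lam.rowLen (i + 1) < mu.rowLen i).card)
            (mu.card + k - lam.card) : ℤ)) ∧
    (mu ≤ lam → IsHorizontalStrip mu lam → mu.card + k < lam.card →
      dCoeff mu (rect 1 k) lam = 0) ∧
    (¬(mu ≤ lam ∧ IsHorizontalStrip mu lam) → dCoeff mu (rect 1 k) lam = 0) := by
  rw [dCoeff_rect_one hk]
  refine ⟨fun hle hstrip hcard => by rw [card_isPieri hle hstrip hcard]; rfl,
    fun _ _ hcard => ?_, fun hnot => ?_⟩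
  · have : IsEmpty {T : SVT lam.cells // IsPieri mu k T} := ⟨fun ⟨T, hT⟩ => by
      obtain ⟨S, -, h, -⟩ := hT.exists_entry_eq
      omega⟩
    simp
  · have : IsEmpty {T : SVT lam.cells // IsPieri mu k T} :=
      ⟨fun ⟨T, hT⟩ => hnot ⟨hT.le, hT.isHorizontalStrip⟩⟩
    simp
end

section
/- (Specializing a variable to 1 removes the top row) For every partition λ and every m ≥ 1, substituting the value 1 for the last variable in the stable Grothendieck polynomial G_λ(x_1,…,x_m,x_{m+1}) in m+1 variables yields G_λ(x_1,…,x_m,1) = G_{λ̄}(x_1,…,x_m) in ℤ[x_1,…,x_m], where λ̄ = (λ_2, λ_3, …) is the partition obtained by removing the top row of λ. -/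
open MvPolynomial

namespace SVT

variable {cells : Finset (ℕ × ℕ)} {m : ℕ}

theorem entry_injective_s10 : Function.Injective (entry : SVT cells → ℕ × ℕ → Finset ℕ) := by
  rintro ⟨⟩ ⟨⟩ rfl
  rfl

theorem finite_bounded (cells : Finset (ℕ × ℕ)) (m : ℕ) :
    {T : SVT cells | T.Bounded m}.Finite := by
  let r : SVT cells → (cells → Finset ℕ) := fun T c => T.entry c
  have hr : Function.Injective r := fun T U h => entry_injective_s10 <| funext fun c => by
    by_cases hc : c ∈ cells
    · exact congrFun h ⟨c, hc⟩
    · rw [T.eq_empty_of_not_mem c hc, U.eq_empty_of_not_mem c hc]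
  refine Set.Finite.of_finite_image (f := r) ?_ hr.injOn
  refine (Set.Finite.pi' (t := fun _ => (↑(Finset.range m).powerset : Set (Finset ℕ)))
    fun _ => Finset.finite_toSet _).subset ?_
  rintro _ ⟨T, hT, rfl⟩ c
  rw [Finset.mem_coe, Finset.mem_powerset]
  exact fun x hx => Finset.mem_range.2 (hT c x hx)

/-- The finite set of set-valued tableaux with `0`-based entries `< m`. -/
noncomputable def bounded (cells : Finset (ℕ × ℕ)) (m : ℕ) : Finset (SVT cells) :=
  (finite_bounded cells m).toFinset

@[simp]
theorem mem_bounded {T : SVT cells} : T ∈ bounded cells m ↔ T.Bounded m := by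
  simp [bounded]

/-- The signed contribution `(-1)^(|s|-1) ∏_{i ∈ s} h i` of a box filled with `s`. -/
def boxWeight {R : Type*} [CommRing R] (h : ℕ → R) (s : Finset ℕ) : R :=
  -∏ i ∈ s, -h i

theorem smul_monomial_eq_prod_boxWeight (T : SVT cells) :
    ((-1 : ℤ) ^ (T.size - cells.card)) • T.monomial =
      ∏ c ∈ cells, boxWeight (X : ℕ → MvPolynomial ℕ ℤ) (T.entry c) := by
  have hle : cells.card ≤ T.size := by
    rw [Finset.card_eq_sum_ones]
    exact Finset.sum_le_sum fun c hc => (T.nonempty_of_mem c hc).card_pos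
  have hsign : (-1 : MvPolynomial ℕ ℤ) ^ (T.size - cells.card) =
      (-1) ^ cells.card * (-1) ^ T.size := by
    obtain ⟨k, hk⟩ := Nat.exists_eq_add_of_le hle
    rw [hk, Nat.add_sub_cancel_left, pow_add, ← mul_assoc, ← mul_pow]
    simp
  rw [zsmul_eq_mul]
  push_cast
  rw [hsign, mul_assoc]
  simp only [boxWeight, Finset.prod_neg, monomial, size, Finset.prod_mul_distrib,
    Finset.prod_pow_eq_pow_sum]

theorem grothendieck_eq_sum (cells : Finset (ℕ × ℕ)) (m : ℕ) :
    grothendieck cells m = ∑ T ∈ bounded cells m,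
      ∏ c ∈ cells, boxWeight (X : ℕ → MvPolynomial ℕ ℤ) (T.entry c) := by
  simp only [grothendieck, smul_monomial_eq_prod_boxWeight]
  rw [← finsum_mem_coe_finset]
  simp

theorem map_boxWeight {R S : Type*} [CommRing R] [CommRing S] (φ : R →+* S) (h : ℕ → R)
    (s : Finset ℕ) : φ (boxWeight h s) = boxWeight (fun i => φ (h i)) s := by
  simp [boxWeight]

theorem boxWeight_symmDiff_singleton {R : Type*} [CommRing R] {h : ℕ → R} (hm : h m = 1)
    (s : Finset ℕ) : boxWeight h (symmDiff s {m}) = -boxWeight h s := by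
  by_cases hs : m ∈ s
  · have : symmDiff s {m} = s.erase m := by ext x; simp [Finset.mem_symmDiff]; grind
    rw [this, boxWeight, boxWeight, ← Finset.mul_prod_erase s _ hs, hm]
    ring
  · have : symmDiff s {m} = insert m s := by ext x; simp [Finset.mem_symmDiff]; grind
    rw [this, boxWeight, boxWeight, Finset.prod_insert hs, hm]
    ring

/-- A box of `T` is free if the entry `m`, taken to be the largest one allowed, may be added to
or removed from it irrespective of the occurrences of `m` elsewhere. -/
def IsFree (T : SVT cells) (m : ℕ) (c : ℕ × ℕ) : Prop :=
  c ∈ cells ∧ (c.1 + 1, c.2) ∉ cells ∧ (∃ x ∈ T.entry c, x < m) ∧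
    ∀ x ∈ T.entry (c.1, c.2 + 1), m ≤ x

/-- Toggle the occurrence of `m` in a free box. -/
def toggle (T : SVT cells) (hT : T.Bounded (m + 1)) (c : ℕ × ℕ) (hc : T.IsFree m c) :
    SVT cells where
  entry := Function.update T.entry c (symmDiff (T.entry c) {m})
  nonempty_of_mem d hd := by
    obtain rfl | hdc := eq_or_ne d c
    · obtain ⟨-, -, ⟨x, hx, hxm⟩, -⟩ := hc
      exact ⟨x, by simp [Finset.mem_symmDiff, hx, hxm.ne]⟩
    · simpa [hdc] using T.nonempty_of_mem d hd
  eq_empty_of_not_mem d hd := by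
    have hdc : d ≠ c := fun h => hd (h ▸ hc.1)
    simpa [hdc] using T.eq_empty_of_not_mem d hd
  row_weak i j h₁ h₂ a ha b hb := by
    have hrow := T.row_weak i j h₁ h₂
    obtain ⟨-, -, -, hright⟩ := hc
    simp only [Function.update_apply] at ha hb
    split_ifs at ha hb with hl hr hr
    · grind
    · subst hl
      have hbm := hright b hb
      have ham : a ≤ m := by
        simp only [Finset.mem_symmDiff, Finset.mem_singleton] at ha
        rcases ha with ha | ha
        · exact Nat.lt_succ_iff.1 (hT _ a ha.1)
        · exact ha.1.le
      exact ham.trans hbm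
    · subst hr
      simp only [Finset.mem_symmDiff, Finset.mem_singleton] at hb
      rcases hb with hb | hb
      · exact hrow a ha b hb.1
      · exact hb.1 ▸ Nat.lt_succ_iff.1 (hT _ a ha)
    · exact hrow a ha b hb
  col_strict i j h₁ h₂ a ha b hb := by
    have hcol := T.col_strict i j h₁ h₂
    obtain ⟨-, hbelow, ⟨x, hx, hxm⟩, -⟩ := hc
    have hl : (i, j) ≠ c := by rintro rfl; exact hbelow h₂
    rw [Function.update_of_ne hl] at ha
    rw [Function.update_apply] at hb
    split_ifs at hb with hr
    · subst hr
      simp only [Finset.mem_symmDiff, Finset.mem_singleton] at hb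
      rcases hb with hb | hb
      · exact hcol a ha b hb.1
      · exact hb.1 ▸ (hcol a ha x hx).trans hxm
    · exact hcol a ha b hb

section toggle

variable {T : SVT cells} (hT : T.Bounded (m + 1)) {c : ℕ × ℕ} (hc : T.IsFree m c)

theorem Bounded.toggle : (T.toggle hT c hc).Bounded (m + 1) := by
  intro d x hx
  simp only [SVT.toggle, Function.update_apply] at hx
  split_ifs at hx with h
  · subst h
    simp only [Finset.mem_symmDiff, Finset.mem_singleton] at hx
    rcases hx with hx | hx
    · exact hT _ x hx.1
    · omega
  · exact hT d x hx

theorem mem_entry_toggle {x : ℕ} (hx : x ≠ m) (d : ℕ × ℕ) :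
    x ∈ (T.toggle hT c hc).entry d ↔ x ∈ T.entry d := by
  simp only [toggle, Function.update_apply]
  split_ifs with h
  · simp [Finset.mem_symmDiff, hx, h]
  · rfl

theorem isFree_toggle : (T.toggle hT c hc).IsFree m = T.IsFree m := by
  have h (d : ℕ × ℕ) {x : ℕ} (hx : x < m) := mem_entry_toggle hT hc hx.ne d
  funext d
  simp only [IsFree]
  congr! 3
  · exact exists_congr fun x => and_congr_left (h _)
  · simp only [← not_lt]
    exact forall_congr' fun x => by grind

theorem toggle_toggle (hT' : (T.toggle hT c hc).Bounded (m + 1))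
    (hc' : (T.toggle hT c hc).IsFree m c) : (T.toggle hT c hc).toggle hT' c hc' = T := by
  apply entry_injective_s10
  simp [toggle]

theorem prod_boxWeight_toggle {R : Type*} [CommRing R] {h : ℕ → R} (hm : h m = 1) :
    ∏ d ∈ cells, boxWeight h ((T.toggle hT c hc).entry d) =
      -∏ d ∈ cells, boxWeight h (T.entry d) := by
  rw [← Finset.mul_prod_erase cells _ hc.1,
    ← Finset.mul_prod_erase cells (fun d => boxWeight h (T.entry d)) hc.1, ← neg_mul]
  congr 1
  · simp [toggle, boxWeight_symmDiff_singleton hm]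
  · refine Finset.prod_congr rfl fun d hd => ?_
    simp [toggle, Finset.ne_of_mem_erase hd]

end toggle

open Classical in
/-- After setting the largest variable to `1`, the tableaux with a free box cancel. -/
theorem sum_prod_boxWeight_eq_sum_filter {R : Type*} [CommRing R] {h : ℕ → R} (hm : h m = 1) :
    ∑ T ∈ bounded cells (m + 1), ∏ c ∈ cells, boxWeight h (T.entry c) =
      ∑ T ∈ bounded cells (m + 1) with ∀ c, ¬T.IsFree m c,
        ∏ c ∈ cells, boxWeight h (T.entry c) := by
  rw [← Finset.sum_filter_add_sum_filter_not (bounded cells (m + 1))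
    (fun T => ∀ c, ¬T.IsFree m c), add_eq_left]
  have hb {T} (hT : T ∈ (bounded cells (m + 1)).filter fun T => ¬∀ c, ¬T.IsFree m c) :
      T.Bounded (m + 1) := by simp_all
  have hf {T} (hT : T ∈ (bounded cells (m + 1)).filter fun T => ¬∀ c, ¬T.IsFree m c) :
      T.IsFree m (Classical.epsilon (T.IsFree m)) :=
    Classical.epsilon_spec (by simpa using (Finset.mem_filter.1 hT).2)
  refine Finset.sum_involution (fun T hT => T.toggle (hb hT) _ (hf hT)) ?_ ?_ ?_ ?_
  · intro T hT
    rw [prod_boxWeight_toggle _ _ hm, add_neg_cancel]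
  · intro T hT _ heq
    have := congrFun (congrArg entry heq) (Classical.epsilon (T.IsFree m))
    simp [toggle] at this
  · intro T hT
    simp only [Finset.mem_filter, mem_bounded, isFree_toggle]
    exact ⟨(hb hT).toggle _, (Finset.mem_filter.1 hT).2⟩
  · intro T hT
    simp only [isFree_toggle]
    exact toggle_toggle ..

end SVT

section RemoveTopRow

variable {lam mu : YoungDiagram}

theorem YoungDiagram.mem_iff_succ_mem_of_rowLen_eq
    (hmu : ∀ i, mu.rowLen i = lam.rowLen (i + 1)) (c : ℕ × ℕ) :
    c ∈ mu ↔ (c.1 + 1, c.2) ∈ lam := by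
  rw [YoungDiagram.mem_iff_lt_rowLen, hmu, ← YoungDiagram.mem_iff_lt_rowLen]

theorem YoungDiagram.mem_of_succ_mem {i j : ℕ} (h : (i + 1, j) ∈ lam) : (i, j) ∈ lam :=
  lam.up_left_mem (Nat.le_succ i) le_rfl h

namespace SVT

variable {m : ℕ}

theorem lt_of_mem_entry {T : SVT lam.cells} (hT : T.Bounded (m + 1)) {i j : ℕ}
    (h : (i + 1, j) ∈ lam) {a : ℕ} (ha : a ∈ T.entry (i, j)) : a < m := by
  obtain ⟨b, hb⟩ := T.nonempty_of_mem (i + 1, j) h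
  exact (T.col_strict i j (YoungDiagram.mem_of_succ_mem h) h a ha b hb).trans_le
    (Nat.lt_succ_iff.1 (hT _ b hb))

/-- In a tableau without free boxes, the boxes with nothing below contain only `m`. -/
theorem entry_eq_singleton {T : SVT lam.cells} (hT : T.Bounded (m + 1))
    (hfree : ∀ c, ¬T.IsFree m c) {i j : ℕ} (hmem : (i, j) ∈ lam) (hbelow : (i + 1, j) ∉ lam) :
    T.entry (i, j) = {m} := by
  have key : ∀ k j, lam.rowLen i ≤ j + k → (i + 1, j) ∉ lam → ∀ x ∈ T.entry (i, j), m ≤ x := by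
    intro k
    induction k with
    | zero =>
      intro j hj _ x hx
      have : (i, j) ∉ lam.cells := by
        rw [YoungDiagram.mem_cells, YoungDiagram.mem_iff_lt_rowLen]
        omega
      simp [T.eq_empty_of_not_mem _ this] at hx
    | succ k ih =>
      intro j hj hbelow x hx
      by_contra! hxm
      have hmem : (i, j) ∈ lam.cells := by
        by_contra h
        simp [T.eq_empty_of_not_mem _ h] at hx
      exact hfree (i, j) ⟨hmem, hbelow, ⟨x, hx, hxm⟩, ih (j + 1) (by omega)
        fun h => hbelow (lam.up_left_mem le_rfl (Nat.le_succ j) h)⟩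
  refine Finset.eq_singleton_iff_nonempty_unique_mem.2 ⟨T.nonempty_of_mem _ hmem, fun x hx => ?_⟩
  exact le_antisymm (Nat.lt_succ_iff.1 (hT _ x hx))
    (key (lam.rowLen i) j (Nat.le_add_left _ _) hbelow x hx)

/-- The restriction of a tableau to a smaller diagram. -/
def restrict (T : SVT lam.cells) (hle : mu ≤ lam) : SVT mu.cells where
  entry c := if c ∈ mu then T.entry c else ∅
  nonempty_of_mem c hc := by
    rw [YoungDiagram.mem_cells] at hc
    simpa [hc] using T.nonempty_of_mem c (hle hc)
  eq_empty_of_not_mem c hc := if_neg hc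
  row_weak i j h₁ h₂ := by
    rw [YoungDiagram.mem_cells] at h₁ h₂
    simpa [h₁, h₂] using T.row_weak i j (hle h₁) (hle h₂)
  col_strict i j h₁ h₂ := by
    rw [YoungDiagram.mem_cells] at h₁ h₂
    simpa [h₁, h₂] using T.col_strict i j (hle h₁) (hle h₂)

/-- Extend a tableau by boxes filled with `{m}`. -/
def extend (U : SVT mu.cells) (hU : U.Bounded m) (hmu : ∀ c, c ∈ mu ↔ (c.1 + 1, c.2) ∈ lam) :
    SVT lam.cells where
  entry c := if c ∈ mu then U.entry c else if c ∈ lam then {m} else ∅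
  nonempty_of_mem c hc := by
    rw [YoungDiagram.mem_cells] at hc
    split_ifs with h
    · exact U.nonempty_of_mem c h
    · exact Finset.singleton_nonempty m
  eq_empty_of_not_mem c hc := by
    rw [YoungDiagram.mem_cells] at hc
    rw [if_neg fun h => hc (YoungDiagram.mem_of_succ_mem ((hmu c).1 h)), if_neg hc]
  row_weak i j h₁ h₂ a ha b hb := by
    rw [YoungDiagram.mem_cells] at h₁ h₂
    simp only [h₁, h₂, if_true] at ha hb
    split_ifs at ha hb with hl hr hr
    · exact U.row_weak i j hl hr a ha b hb
    · rw [Finset.mem_singleton.1 hb]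
      exact (hU _ a ha).le
    · exact absurd (mu.up_left_mem le_rfl (Nat.le_succ j) hr) hl
    · rw [Finset.mem_singleton.1 ha, Finset.mem_singleton.1 hb]
  col_strict i j h₁ h₂ a ha b hb := by
    rw [YoungDiagram.mem_cells] at h₁ h₂
    have hl : (i, j) ∈ mu := (hmu (i, j)).2 h₂
    simp only [hl, h₂, if_true] at ha hb
    split_ifs at hb with hr
    · exact U.col_strict i j hl hr a ha b hb
    · rw [Finset.mem_singleton.1 hb]
      exact hU _ a ha

open Classical in
/-- Tableaux without free boxes correspond to tableaux on the diagram with the top row removed. -/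
theorem sum_filter_prod_boxWeight_eq {R : Type*} [CommRing R] {h : ℕ → R} (hm : h m = 1)
    (hmu : ∀ c, c ∈ mu ↔ (c.1 + 1, c.2) ∈ lam) :
    ∑ T ∈ bounded lam.cells (m + 1) with ∀ c, ¬T.IsFree m c,
        ∏ c ∈ lam.cells, boxWeight h (T.entry c) =
      ∑ U ∈ bounded mu.cells m, ∏ c ∈ mu.cells, boxWeight h (U.entry c) := by
  have hle : mu ≤ lam := fun c hc => YoungDiagram.mem_of_succ_mem ((hmu c).1 hc)
  have hsingle {T : SVT lam.cells}
      (hT : T ∈ (bounded lam.cells (m + 1)).filter fun T => ∀ c, ¬T.IsFree m c) {c : ℕ × ℕ}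
      (hc : c ∈ lam) (hc' : c ∉ mu) : T.entry c = {m} := by
    rw [Finset.mem_filter, mem_bounded] at hT
    exact entry_eq_singleton hT.1 hT.2 hc fun h => hc' ((hmu c).2 h)
  refine Finset.sum_bij' (fun T _ => T.restrict hle)
    (fun U hU => U.extend (mem_bounded.1 hU) hmu) ?_ ?_ ?_ ?_ ?_
  · intro T hT
    rw [Finset.mem_filter, mem_bounded] at hT
    rw [mem_bounded]
    intro c x hx
    simp only [restrict] at hx
    split_ifs at hx with hc
    · exact lt_of_mem_entry hT.1 ((hmu c).1 hc) hx
    · simp at hx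
  · intro U hU
    rw [mem_bounded] at hU
    rw [Finset.mem_filter, mem_bounded]
    constructor
    · intro c x hx
      simp only [extend] at hx
      split_ifs at hx with hc hc'
      · exact (hU c x hx).trans (Nat.lt_succ_self m)
      · rw [Finset.mem_singleton.1 hx]
        exact Nat.lt_succ_self m
      · simp at hx
    · rintro c ⟨hc, hbelow, ⟨x, hx, hxm⟩, -⟩
      rw [YoungDiagram.mem_cells] at hc
      have hc' : c ∉ mu := fun h => hbelow ((hmu c).1 h)
      simp only [extend, hc, hc', if_true, if_false, Finset.mem_singleton] at hx
      exact hxm.ne hx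
  · intro T hT
    apply entry_injective_s10
    funext c
    simp only [extend, restrict]
    split_ifs with hc hc'
    · rfl
    · exact (hsingle hT hc' hc).symm
    · exact (T.eq_empty_of_not_mem c hc').symm
  · intro U hU
    apply entry_injective_s10
    funext c
    simp only [extend, restrict]
    split_ifs with hc
    · rfl
    · exact (U.eq_empty_of_not_mem c hc).symm
  · intro T hT
    rw [← Finset.prod_subset (show mu.cells ⊆ lam.cells from hle)]
    · refine Finset.prod_congr rfl fun c hc => ?_
      rw [YoungDiagram.mem_cells] at hc
      simp [restrict, hc]
    · intro c hc hc'
      rw [hsingle hT hc hc']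
      simp [boxWeight, hm]

theorem boxWeight_congr {R : Type*} [CommRing R] {h h' : ℕ → R} {s : Finset ℕ}
    (hs : ∀ i ∈ s, h i = h' i) : boxWeight h s = boxWeight h' s := by
  rw [boxWeight, boxWeight, Finset.prod_congr rfl fun i hi => by rw [hs i hi]]

end SVT

end RemoveTopRow

/-- **Specializing a variable to 1 removes the top row** (Section 7): for a
partition `λ` and `m ≥ 1`, substituting `1` for the last variable of
`G_λ(x_1,…,x_m,x_{m+1})` yields `G_{λ̄}(x_1,…,x_m)`, where `λ̄` is `λ` with its
top row removed (characterized by `λ̄_i = λ_{i+1}` for all `i`). -/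
theorem grothendieck_specialize_one (lam mu : YoungDiagram)
    (hmu : ∀ i, mu.rowLen i = lam.rowLen (i + 1)) (m : ℕ) (hm : 1 ≤ m) :
    MvPolynomial.aeval
        (fun i : ℕ => if i = m then (1 : MvPolynomial ℕ ℤ) else MvPolynomial.X i)
        (grothendieck lam.cells (m + 1)) =
      grothendieck mu.cells m := by
  classical
  set f : ℕ → MvPolynomial ℕ ℤ := fun i => if i = m then 1 else X i with hf
  have hfm : f m = 1 := if_pos rfl
  have hmap (s : Finset ℕ) : aeval f (SVT.boxWeight (X : ℕ → MvPolynomial ℕ ℤ) s) =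
      SVT.boxWeight f s := by
    simpa using SVT.map_boxWeight (aeval f : MvPolynomial ℕ ℤ →ₐ[ℤ] _).toRingHom X s
  rw [SVT.grothendieck_eq_sum, SVT.grothendieck_eq_sum]
  simp only [map_sum, map_prod, hmap]
  rw [SVT.sum_prod_boxWeight_eq_sum_filter hfm,
    SVT.sum_filter_prod_boxWeight_eq hfm (YoungDiagram.mem_iff_succ_mem_of_rowLen_eq hmu)]
  refine Finset.sum_congr rfl fun U hU => Finset.prod_congr rfl fun c _ => ?_
  exact SVT.boxWeight_congr fun i hi => if_neg (SVT.mem_bounded.1 hU c i hi).ne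
end

section
/- (Schur expansion of a stable Grothendieck polynomial) For every partition λ and every m ≥ 1, the identity G_λ(x_1,…,x_m) = Σ_{μ} (−1)^{|μ/λ|}·g_{λμ}·s_μ(x_1,…,x_m) holds in ℤ[x_1,…,x_m], where the sum is over all partitions μ ⊇ λ with at most m rows; here g_{λμ} is the number of fillings of the boxes of μ/λ with single positive integers that strictly increase along each row and down each column and such that every entry in row i lies in {1,…,i−1}, and s_μ(x_1,…,x_m) = Σ_T x^T is the Schur polynomial, summed over all semistandard tableaux T of shape μ with entries in {1,…,m} (one entry per box, rows weakly increasing, columns strictly increasing). -/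
open MvPolynomial

/-- The Schur polynomial `s_μ(x_1,…,x_m)`: the sum of `x^T` over all
semistandard tableaux of shape `μ` with entries in `{1,…,m}`, realized as
set-valued tableaux all of whose boxes are singletons. -/
noncomputable def schurPoly (mu : YoungDiagram) (m : ℕ) : MvPolynomial ℕ ℤ :=
  ∑ᶠ (T : SVT mu.cells)
    (_ : T.Bounded m ∧ ∀ c ∈ mu.cells, (T.entry c).card = 1), T.monomial

/-- `g_{λμ}`: the number of fillings of `μ/λ` with single positive integers
that strictly increase along rows and down columns and whose entries in row
`i` (`1`-based) lie in `{1,…,i-1}`; with `0`-based rows, the entries of row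
`i` lie in `{1,…,i}`. -/
noncomputable def gCoeff (lam mu : YoungDiagram) : ℕ :=
  Nat.card {f : ℕ × ℕ → ℕ //
    (∀ c ∈ mu.cells \ lam.cells, 1 ≤ f c ∧ f c ≤ c.1) ∧
    (∀ c ∉ mu.cells \ lam.cells, f c = 0) ∧
    (∀ i j, (i, j) ∈ mu.cells \ lam.cells → (i, j + 1) ∈ mu.cells \ lam.cells →
      f (i, j) < f (i, j + 1)) ∧
    (∀ i j, (i, j) ∈ mu.cells \ lam.cells → (i + 1, j) ∈ mu.cells \ lam.cells →
      f (i, j) < f (i + 1, j))}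

section Det
variable {R : Type*} [CommRing R]

/-- The alternant `det (x_i ^ (l_j + m - 1 - j) * (1 + t x_i) ^ p_j)`. -/
noncomputable def powerDet (x : ℕ → R) (t : R) {m : ℕ} (p l : Fin m → ℕ) : R :=
  (Matrix.of fun j i : Fin m => x i ^ (l j + (m - 1 - j)) * (1 + t * x i) ^ p j).det

/-- The weight of a row in which the entries of the cells `k, …, b - 1` are the single variable `y`,
and which may moreover have `y` added to the cell `k - 1` if `a < k`. -/
noncomputable def stepWeight (y t : R) (a b k : ℕ) : R :=
  y ^ (b - k) * if a < k then 1 + t * y else 1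

lemma sub_mul_sum_stepWeight (x y t : R) {a b : ℕ} (hab : a ≤ b) :
    (x - y) * ∑ k ∈ Finset.Icc a b, stepWeight y t a b k * x ^ k =
      (1 + t * y) * x ^ (b + 1) - y ^ (b - a + 1) * (x ^ a * (1 + t * x)) := by
  induction b, hab using Nat.le_induction with
  | base => simp [stepWeight]; ring
  | succ b hab ih =>
    have hs : ∑ k ∈ Finset.Icc a b, stepWeight y t a (b + 1) k * x ^ k =
        y * ∑ k ∈ Finset.Icc a b, stepWeight y t a b k * x ^ k := by
      rw [Finset.mul_sum]
      refine Finset.sum_congr rfl fun k hk => ?_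
      have hk := (Finset.mem_Icc.1 hk).2
      simp only [stepWeight, Nat.sub_add_comm hk, pow_succ]
      ring
    rw [← Finset.insert_Icc_right_eq_Icc_add_one (by omega), Finset.sum_insert (by simp), hs,
      mul_add, mul_left_comm (x - y) y, ih]
    have : a < b + 1 := by omega
    simp only [stepWeight, this, if_true, Nat.sub_self, Nat.sub_add_comm hab]
    ring

lemma powerDet_succ [IsDomain R] (x : ℕ → R) (t : R) {m : ℕ} (l : Fin (m + 1) → ℕ)
    (hl : ∀ i : Fin m, l i.succ ≤ l i.castSucc) (hm : 1 + t * x m ≠ 0) :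
    powerDet x t (fun j => (j : ℕ)) l =
      x m ^ l (Fin.last m) * (∏ i ∈ Finset.range m, (x i - x m)) *
        (Matrix.of fun j i : Fin m => ∑ k ∈ Finset.Icc (l j.succ) (l j.castSucc),
          stepWeight (x m) t (l j.succ) (l j.castSucc) k *
            (x i ^ (k + (m - 1 - j)) * (1 + t * x i) ^ (j : ℕ))).det := by
  set F : Matrix (Fin (m + 1)) (Fin (m + 1)) R :=
    Matrix.of fun j i => x i ^ (l j + (m + 1 - 1 - j)) * (1 + t * x i) ^ (j : ℕ) with hF
  set P : Matrix (Fin (m + 1)) (Fin (m + 1)) R :=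
    Matrix.of fun i j => if i = j then (if i = Fin.last m then 1 else 1 + t * x m)
      else if (j : ℕ) = i + 1 then - x m ^ (l i - l j + 1) else 0 with hP
  have hdP : P.det = (1 + t * x m) ^ m := by
    rw [Matrix.det_of_isUpperTriangular, Fin.prod_univ_castSucc]
    · simp [hP, Fin.castSucc_ne_last]
    · intro i j hij
      have : (j : ℕ) < i := hij
      simp only [hP, Matrix.of_apply]
      rw [if_neg (by rintro rfl; omega), if_neg (by omega)]
  have hlast : ∀ i, (P * F) (Fin.last m) i = F (Fin.last m) i := by
    intro i
    rw [Matrix.mul_apply, Finset.sum_eq_single (Fin.last m)]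
    · simp [hP]
    · intro b _ hb
      have := b.is_lt
      simp only [hP, Matrix.of_apply]
      rw [if_neg (Ne.symm hb), if_neg (by simp; omega), zero_mul]
    · simp
  have hcast : ∀ (j : Fin m) i, (P * F) j.castSucc i = (x i - x m) *
      ∑ k ∈ Finset.Icc (l j.succ) (l j.castSucc),
          stepWeight (x m) t (l j.succ) (l j.castSucc) k *
            (x i ^ (k + (m - 1 - j)) * (1 + t * x i) ^ (j : ℕ)) := by
    intro j i
    have h1 : (P * F) j.castSucc i = (1 + t * x m) * F j.castSucc i -
        x m ^ (l j.castSucc - l j.succ + 1) * F j.succ i := by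
      rw [Matrix.mul_apply, ← Finset.sum_subset (Finset.subset_univ {j.castSucc, j.succ}),
        Finset.sum_pair (Fin.castSucc_lt_succ).ne]
      · simp [hP, Fin.castSucc_ne_last, (Fin.castSucc_lt_succ (i := j)).ne]; ring
      · intro b _ hb
        simp only [Finset.mem_insert, Finset.mem_singleton, not_or] at hb
        simp only [hP, Matrix.of_apply]
        rw [if_neg (Ne.symm hb.1), if_neg, zero_mul]
        intro h
        exact hb.2 (Fin.ext (by simpa using h))
    have h2 : ∑ k ∈ Finset.Icc (l j.succ) (l j.castSucc),
          stepWeight (x m) t (l j.succ) (l j.castSucc) k *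
            (x i ^ (k + (m - 1 - j)) * (1 + t * x i) ^ (j : ℕ)) =
        (∑ k ∈ Finset.Icc (l j.succ) (l j.castSucc),
          stepWeight (x m) t (l j.succ) (l j.castSucc) k * x i ^ k) *
            (x i ^ (m - 1 - j) * (1 + t * x i) ^ (j : ℕ)) := by
      rw [Finset.sum_mul]
      refine Finset.sum_congr rfl fun k _ => ?_
      ring
    rw [h1, h2, ← mul_assoc, sub_mul_sum_stepWeight _ _ _ (hl j)]
    have h3 : m - j = (m - 1 - j) + 1 := by omega
    have h4 : m - (j + 1) = m - 1 - j := by omega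
    simp only [hF, Matrix.of_apply, Fin.val_castSucc, Fin.val_succ, Nat.add_sub_cancel, h3, h4]
    ring
  have hdet : (P * F).det = (1 + t * x m) ^ m * (x m ^ l (Fin.last m) *
      (∏ i ∈ Finset.range m, (x i - x m)) *
        (Matrix.of fun j i : Fin m => ∑ k ∈ Finset.Icc (l j.succ) (l j.castSucc),
          stepWeight (x m) t (l j.succ) (l j.castSucc) k *
            (x i ^ (k + (m - 1 - j)) * (1 + t * x i) ^ (j : ℕ))).det) := by
    rw [Matrix.det_succ_column _ (Fin.last m), Finset.sum_eq_single (Fin.last m)]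
    · rw [hlast, Fin.succAbove_last, ← Fin.prod_univ_eq_prod_range (fun i => x i - x m), mul_assoc
        (x m ^ _), ← Matrix.det_mul_row]
      have : (P * F).submatrix Fin.castSucc Fin.castSucc = Matrix.of fun j i : Fin m =>
          (x i - x m) * (Matrix.of fun j i : Fin m => ∑ k ∈ Finset.Icc (l j.succ) (l j.castSucc),
          stepWeight (x m) t (l j.succ) (l j.castSucc) k *
            (x i ^ (k + (m - 1 - j)) * (1 + t * x i) ^ (j : ℕ))) j i := by
        ext j i
        simp [hcast]
      rw [this]
      simp [hF, ← two_mul, pow_mul]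
      ring
    · intro b _ hb
      obtain ⟨j, rfl⟩ := Fin.exists_castSucc_eq.2 hb
      rw [hcast]
      simp
    · simp
  rw [Matrix.det_mul, hdP] at hdet
  exact mul_left_cancel₀ (pow_ne_zero _ hm) hdet

lemma det_sum_eq {ι : Type*} [Fintype ι] [DecidableEq ι] (A : ι → Finset ℕ) (g : ι → ℕ → ι → R) :
    (Matrix.of fun j i => ∑ k ∈ A j, g j k i).det =
      ∑ r ∈ Fintype.piFinset A, (Matrix.of fun j i => g j (r j) i).det := by
  have := (Matrix.detRowAlternating (n := ι) (R := R)).toMultilinearMap.map_sum_finset g A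
  refine Eq.trans (congrArg Matrix.det ?_) this
  ext j i
  simp [Finset.sum_apply]

lemma powerDet_branching [IsDomain R] (x : ℕ → R) (t : R) {m : ℕ} (l : Fin (m + 1) → ℕ)
    (hl : ∀ i : Fin m, l i.succ ≤ l i.castSucc) (hm : 1 + t * x m ≠ 0) :
    powerDet x t (fun j => (j : ℕ)) l =
      x m ^ l (Fin.last m) * (∏ i ∈ Finset.range m, (x i - x m)) *
        ∑ k ∈ Fintype.piFinset fun i : Fin m => Finset.Icc (l i.succ) (l i.castSucc),
          (∏ i, stepWeight (x m) t (l i.succ) (l i.castSucc) (k i)) *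
            powerDet x t (fun j => (j : ℕ)) k := by
  rw [powerDet_succ x t l hl hm, det_sum_eq]
  congr 1
  refine Finset.sum_congr rfl fun k _ => ?_
  rw [powerDet, ← Matrix.det_mul_column]
  rfl

lemma powerDet_lower (x : ℕ → R) {m : ℕ} (K : ℕ) (l : Fin m → ℕ) (hl : Antitone l) :
    powerDet x (-1) (fun j => min (j : ℕ) (K + 1)) l =
      ∑ n ∈ (Fintype.piFinset fun i : Fin m =>
          Finset.Icc (l i) (l i + if K + 1 ≤ (i : ℕ) then 1 else 0)) with Antitone n,
        (-1) ^ (∑ i, (n i - l i)) * powerDet x (-1) (fun j => min (j : ℕ) K) n := by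
  have h1 : powerDet x (-1) (fun j => min (j : ℕ) (K + 1)) l =
      (Matrix.of fun j i : Fin m => ∑ k ∈
        Finset.Icc (l j) (l j + if K + 1 ≤ (j : ℕ) then 1 else 0),
        (-1) ^ (k - l j) * (x i ^ (k + (m - 1 - j)) * (1 + -1 * x i) ^ (min (j : ℕ) K))).det := by
    unfold powerDet
    congr 1
    ext j i
    simp only [Matrix.of_apply]
    split_ifs with h
    · rw [← Finset.insert_Icc_right_eq_Icc_add_one (by omega), Finset.sum_insert (by simp)]
      rw [min_eq_right h, min_eq_right (by omega)]
      simp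
      ring
    · rw [min_eq_left (by omega), min_eq_left (by omega)]
      simp
  rw [h1, det_sum_eq, Finset.sum_filter]
  refine Finset.sum_congr rfl fun n hn => ?_
  have h2 : (Matrix.of fun j i : Fin m => (-1 : R) ^ (n j - l j) * (x i ^ (n j + (m - 1 - j)) *
      (1 + -1 * x i) ^ (min (j : ℕ) K))).det = (-1) ^ (∑ i, (n i - l i)) *
        powerDet x (-1) (fun j => min (j : ℕ) K) n := by
    rw [powerDet, ← Finset.prod_pow_eq_pow_sum, ← Matrix.det_mul_column]
    rfl
  rw [h2]
  split_ifs with hanti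
  · rfl
  obtain ⟨m, rfl⟩ : ∃ m', m = m' + 1 := by
    cases m with
    | zero => exact absurd (fun i => i.elim0) hanti
    | succ m => exact ⟨m, rfl⟩
  rw [Fin.antitone_iff_succ_le] at hanti
  push Not at hanti
  obtain ⟨j, hj⟩ := hanti
  have hn1 := Finset.mem_Icc.1 (Fintype.mem_piFinset.1 hn j.succ)
  have hn2 := Finset.mem_Icc.1 (Fintype.mem_piFinset.1 hn j.castSucc)
  have hl' := hl (Fin.castSucc_lt_succ (i := j)).le
  have hK : K + 1 ≤ (j.succ : ℕ) := by
    by_contra h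
    rw [if_neg h] at hn1
    omega
  rw [if_pos hK] at hn1
  simp only [Fin.val_succ] at hK
  rw [powerDet, Matrix.det_zero_of_row_eq (Fin.castSucc_lt_succ (i := j)).ne, mul_zero]
  ext i
  simp only [Matrix.of_apply, Fin.val_succ, Fin.val_castSucc]
  rw [min_eq_right (by omega), min_eq_right (by omega)]
  congr 2
  omega

end Det

section Filling

/-- `f` is a filling of the skew shape `n / l`, extended by zero, with positive entries, increasing
along rows and down columns, such that the entries of row `i` (`0`-based) are at most `i` and at
least `i + 1 - K`. -/
structure IsFilling (K : ℕ) {m : ℕ} (l n : Fin m → ℕ) (f : Fin m → ℕ → ℕ) : Prop where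
  le : ∀ i, l i ≤ n i
  bounds : ∀ i j, l i ≤ j → j < n i → 1 ≤ f i j ∧ f i j ≤ i ∧ i + 1 ≤ f i j + K
  eq_zero : ∀ i j, ¬(l i ≤ j ∧ j < n i) → f i j = 0
  row : ∀ i j j', l i ≤ j → j < j' → j' < n i → f i j < f i j'
  col : ∀ i i' j, i < i' → l i ≤ j → j < n i' → f i j + i' ≤ f i' j + i

lemma finite_setOf_isFilling (K : ℕ) {m : ℕ} (l n : Fin m → ℕ) :
    {f | IsFilling K l n f}.Finite := by
  refine Set.Finite.of_finite_image (f := fun f (i : Fin m) (j : Fin (n i)) => f i j) ?_ ?_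
  · have hfin : {g : (i : Fin m) → Fin (n i) → ℕ |
        ∀ i, g i ∈ {h : Fin (n i) → ℕ | ∀ j, h j ∈ Set.Iic (i : ℕ)}}.Finite :=
      Set.Finite.pi' fun i => Set.Finite.pi' fun _ => Set.finite_Iic (i : ℕ)
    refine hfin.subset ?_
    rintro _ ⟨f, hf, rfl⟩ i j
    by_cases h : l i ≤ j
    · exact (hf.bounds i j h j.2).2.1
    · simp [hf.eq_zero i j (fun h' => h h'.1)]
  · intro f hf g hg hfg
    ext i j
    by_cases h : j < n i
    · exact congrFun (congrFun hfg i) ⟨j, h⟩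
    · rw [hf.eq_zero i j (fun h' => h h'.2), hg.eq_zero i j (fun h' => h h'.2)]

/-- The finite set of all fillings in the sense of `IsFilling`. -/
noncomputable def fillings (K : ℕ) {m : ℕ} (l n : Fin m → ℕ) : Finset (Fin m → ℕ → ℕ) :=
  (finite_setOf_isFilling K l n).toFinset

@[simp] lemma mem_fillings {K m : ℕ} {l n : Fin m → ℕ} {f : Fin m → ℕ → ℕ} :
    f ∈ fillings K l n ↔ IsFilling K l n f := by
  simp [fillings]

/-- The partitions obtained from `l` by adding at most one cell to each row of index greater
than `K`. -/
noncomputable def addStrip (K : ℕ) {m : ℕ} (l : Fin m → ℕ) : Finset (Fin m → ℕ) :=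
  (Fintype.piFinset fun i : Fin m =>
    Finset.Icc (l i) (l i + if K + 1 ≤ (i : ℕ) then 1 else 0)).filter Antitone

lemma mem_addStrip {K m : ℕ} {l n : Fin m → ℕ} :
    n ∈ addStrip K l ↔
      (∀ i, l i ≤ n i ∧ n i ≤ l i + if K + 1 ≤ (i : ℕ) then 1 else 0) ∧ Antitone n := by
  simp [addStrip, Fintype.mem_piFinset]

lemma card_fillings_zero {m : ℕ} {l : Fin m → ℕ} (hl : Antitone l) (n : Fin m → ℕ) :
    (fillings 0 l n).card = if l = n then 1 else 0 := by
  split_ifs with h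
  · subst h
    rw [Finset.card_eq_one]
    refine ⟨fun _ _ => 0, ?_⟩
    ext f
    simp only [mem_fillings, Finset.mem_singleton]
    constructor
    · intro hf
      ext i j
      exact hf.eq_zero i j (by omega)
    · rintro rfl
      exact ⟨fun _ => le_rfl, fun i j _ _ => by omega, fun _ _ _ => rfl,
        fun i j j' _ _ _ => by omega, fun i i' j h h1 h2 => by have := hl h.le; omega⟩
  · rw [Finset.card_eq_zero, Finset.eq_empty_iff_forall_notMem]
    intro f hf
    rw [mem_fillings] at hf
    refine h (funext fun i => le_antisymm (hf.le i) ?_)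
    by_contra! hlt
    have := hf.bounds i (l i) le_rfl hlt
    omega

/-- Extend a filling by the entries `i - K` on the cells of the strip `n / l`. -/
def insertStrip (K : ℕ) {m : ℕ} (l n : Fin m → ℕ) (f : Fin m → ℕ → ℕ) : Fin m → ℕ → ℕ :=
  fun i j => if l i ≤ j ∧ j < n i then i - K else f i j

lemma isFilling_insertStrip {K m : ℕ} {l n μ : Fin m → ℕ} {f : Fin m → ℕ → ℕ}
    (hl : Antitone l) (hμ : Antitone μ) (hn : n ∈ addStrip K l) (hf : IsFilling K n μ f) :
    IsFilling (K + 1) l μ (insertStrip K l n f) := by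
  rw [mem_addStrip] at hn
  obtain ⟨hn, hanti⟩ := hn
  refine ⟨fun i => (hn i).1.trans (hf.le i), fun i j h1 h2 => ?_, fun i j h => ?_,
    fun i j j' h1 h2 h3 => ?_, fun i i' j h1 h2 h3 => ?_⟩
  · have := hn i
    unfold insertStrip
    split_ifs with h
    · split_ifs at this <;> omega
    · have := hf.bounds i j (by omega) h2
      omega
  · have := hn i
    have := hf.le i
    unfold insertStrip
    rw [if_neg (by omega)]
    exact hf.eq_zero i j (by omega)
  · have := hn i
    unfold insertStrip
    have hj' : ¬(l i ≤ j' ∧ j' < n i) := by split_ifs at this <;> omega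
    rw [if_neg hj']
    split_ifs with h
    · have := hf.bounds i j' (by omega) h3
      omega
    · exact hf.row i j j' (by omega) h2 h3
  · have h4 := hn i
    have h5 := hn i'
    have h6 : n i' ≤ n i := hanti h1.le
    have h7 : μ i' ≤ μ i := hμ h1.le
    have h8 : l i' ≤ l i := hl h1.le
    have h9 : (i : ℕ) < i' := h1
    unfold insertStrip
    split_ifs with h h' h'
    · split_ifs at h4 <;> omega
    · have := hf.bounds i' j (by omega) h3
      split_ifs at h4 <;> omega
    · have := hf.bounds i j (by omega) (by omega)
      omega
    · exact hf.col i i' j h1 (by omega) h3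

lemma IsFilling.exists_insertStrip {K m : ℕ} {l μ : Fin m → ℕ} {f : Fin m → ℕ → ℕ}
    (hl : Antitone l) (hμ : Antitone μ) (hf : IsFilling (K + 1) l μ f) :
    ∃ n ∈ addStrip K l, ∃ g, IsFilling K n μ g ∧ insertStrip K l n g = f := by
  obtain ⟨n, hn1⟩ : ∃ n : Fin m → ℕ,
      ∀ i, (n i = l i ∧ (l i < μ i → (i : ℕ) + 1 ≤ f i (l i) + K)) ∨
        (n i = l i + 1 ∧ l i < μ i ∧ f i (l i) + K = i ∧ 1 ≤ f i (l i)) := by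
    refine ⟨fun i => l i + if l i < μ i ∧ f i (l i) + K = i then 1 else 0, fun i => ?_⟩
    have := fun h => hf.bounds i (l i) le_rfl h
    by_cases h : l i < μ i ∧ f i (l i) + K = i
    · right
      exact ⟨by simp [h], h.1, h.2, (this h.1).1⟩
    · left
      simp only [if_neg h]
      refine ⟨rfl, fun h' => ?_⟩
      have := this h'
      omega
  refine ⟨n, ?_, fun i j => if n i ≤ j then f i j else 0, ?_, ?_⟩
  · rw [mem_addStrip]
    constructor
    · intro i
      rcases hn1 i with ⟨h, -⟩ | ⟨h, -, h1, h2⟩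
      · simp [h]
      · simp only [h, show K + 1 ≤ (i : ℕ) by omega, if_true]
        omega
    · intro i i' hii
      rcases hii.eq_or_lt with rfl | hii
      · exact le_rfl
      have h1 := hn1 i
      have h2 := hn1 i'
      have h3 := hl hii.le
      have h4 := hμ hii.le
      by_contra! hlt
      have h5 : l i = l i' := by omega
      have h6 := hf.col i i' (l i) hii le_rfl (by omega)
      rw [← h5] at h2
      omega
  · refine ⟨fun i => ?_, fun i j h1 h2 => ?_, fun i j h => ?_, fun i j j' h1 h2 h3 => ?_,
      fun i i' j h1 h2 h3 => ?_⟩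
    · have := hn1 i
      have := hf.le i
      omega
    · have h3 := hn1 i
      have h4 := hf.bounds i j (by omega) h2
      simp only [h1, if_true]
      refine ⟨h4.1, h4.2.1, ?_⟩
      rcases (show l i ≤ j by omega).eq_or_lt with h5 | h5
      · rw [← h5] at h2 ⊢
        omega
      · have := hf.row i (l i) j le_rfl h5 h2
        have := hf.bounds i (l i) le_rfl (by omega)
        omega
    · have h3 := hn1 i
      split_ifs with h4
      · exact hf.eq_zero i j (by omega)
      · rfl
    · have h4 := hn1 i
      simp only [h1, h1.trans h2.le, if_true]
      exact hf.row i j j' (by omega) h2 h3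
    · have h4 := hn1 i
      have h5 := hn1 i'
      have h6 := hl h1.le
      have h7 := hf.col i i' j h1 (by omega) h3
      have h8 : (i : ℕ) < i' := h1
      simp only [h2, if_true]
      split_ifs with h
      · exact h7
      · exfalso
        have h9 : l i = j := by omega
        have h10 : l i' = j := by omega
        have h11 := hμ h1.le
        rw [h9] at h4
        rw [h10] at h5
        omega
  · ext i j
    have h1 := hn1 i
    simp only [insertStrip]
    split_ifs with h2 h3
    · have : j = l i := by omega
      rw [this]
      omega
    · rfl
    · exact (hf.eq_zero i j (by omega)).symm

lemma card_fillings_succ (K : ℕ) {m : ℕ} {l μ : Fin m → ℕ} (hl : Antitone l) (hμ : Antitone μ) :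
    (fillings (K + 1) l μ).card = ∑ n ∈ addStrip K l, (fillings K n μ).card := by
  rw [← Finset.card_sigma]
  symm
  refine Finset.card_bij (fun a _ => insertStrip K l a.1 a.2) ?_ ?_ ?_
  · rintro ⟨n, f⟩ h
    rw [Finset.mem_sigma, mem_fillings] at h
    exact mem_fillings.2 (isFilling_insertStrip hl hμ h.1 h.2)
  · rintro ⟨n, f⟩ h ⟨n', f'⟩ h' heq
    rw [Finset.mem_sigma, mem_fillings, mem_addStrip] at h h'
    simp only at h h' heq
    have key : ∀ i j, insertStrip K l n f i j = insertStrip K l n' f' i j :=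
      fun i j => by rw [heq]
    have hnn : n = n' := by
      ext i
      have h1 := key i (l i)
      have h2 := h.1.1 i
      have h3 := h'.1.1 i
      have h4 := h.2.bounds i (l i)
      have h5 := h'.2.bounds i (l i)
      have h6 := h.2.le i
      have h7 := h'.2.le i
      unfold insertStrip at h1
      split_ifs at h1 h2 h3 <;> omega
    subst hnn
    have : f = f' := by
      ext i j
      by_cases hij : l i ≤ j ∧ j < n i
      · rw [h.2.eq_zero i j (by omega), h'.2.eq_zero i j (by omega)]
      · simpa [insertStrip, hij] using key i j
    rw [this]
  · intro f hf
    rw [mem_fillings] at hf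
    obtain ⟨n, hn, g, hg, rfl⟩ := hf.exists_insertStrip hl hμ
    exact ⟨⟨n, g⟩, Finset.mem_sigma.2 ⟨hn, mem_fillings.2 hg⟩, rfl⟩

/-- The partitions with at most `m` parts, all of size at most `B`. -/
noncomputable def partitionsInBox (m B : ℕ) : Finset (Fin m → ℕ) :=
  (Fintype.piFinset fun _ => Finset.range (B + 1)).filter Antitone

lemma mem_partitionsInBox {m B : ℕ} {n : Fin m → ℕ} :
    n ∈ partitionsInBox m B ↔ (∀ i, n i ≤ B) ∧ Antitone n := by
  simp [partitionsInBox, Fintype.mem_piFinset]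

lemma powerDet_eq_sum_fillings {R : Type*} [CommRing R] (x : ℕ → R) {m : ℕ} (B K : ℕ)
    (l : Fin m → ℕ) (hl : Antitone l) (hB : ∀ i, l i + K ≤ B) :
    powerDet x (-1) (fun j => min (j : ℕ) K) l =
      ∑ n ∈ partitionsInBox m B, (-1) ^ (∑ i, n i + ∑ i, l i) * ((fillings K l n).card : R) *
        powerDet x (-1) (fun _ => 0) n := by
  induction K generalizing l with
  | zero =>
    rw [Finset.sum_eq_single l]
    · simp [card_fillings_zero hl, ← two_mul]
    · intro n _ hn
      simp [card_fillings_zero hl, Ne.symm hn]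
    · intro h
      exact absurd (mem_partitionsInBox.2 ⟨hB, hl⟩) h
  | succ K ih =>
    rw [powerDet_lower x K l hl]
    change ∑ n ∈ addStrip K l, _ = _
    have hrhs : ∀ n ∈ partitionsInBox m B, (-1 : R) ^ (∑ i, n i + ∑ i, l i) *
        ((fillings (K + 1) l n).card : R) * powerDet x (-1) (fun _ => 0) n =
        ∑ n' ∈ addStrip K l, (-1) ^ (∑ i, n i + ∑ i, l i) * ((fillings K n' n).card : R) *
          powerDet x (-1) (fun _ => 0) n := by
      intro n hn
      rw [card_fillings_succ K hl (mem_partitionsInBox.1 hn).2, Nat.cast_sum, Finset.mul_sum,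
        Finset.sum_mul]
    rw [Finset.sum_congr rfl hrhs, Finset.sum_comm]
    refine Finset.sum_congr rfl fun n' hn' => ?_
    rw [mem_addStrip] at hn'
    rw [ih n' hn'.2, Finset.mul_sum]
    · refine Finset.sum_congr rfl fun n _ => ?_
      rw [← mul_assoc, ← mul_assoc, ← pow_add]
      have h1 : ∑ i, n' i = ∑ i, l i + ∑ i, (n' i - l i) := by
        rw [← Finset.sum_add_distrib]
        exact Finset.sum_congr rfl fun i _ => by have := (hn'.1 i).1; omega
      rw [show ∑ i, (n' i - l i) + (∑ i, n i + ∑ i, n' i) =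
        ∑ i, n i + ∑ i, l i + 2 * ∑ i, (n' i - l i) by omega, pow_add _ _ (2 * _), pow_mul]
      simp
    · intro i
      have h1 := hn'.1 i
      have h2 := hB i
      split_ifs at h1 <;> omega

end Filling

section Tableau

/-- `e` is a set-valued tableau of shape `l` with entries less than `m`, where `m` is the number of
rows. -/
structure IsTableau {m : ℕ} (l : Fin m → ℕ) (e : Fin m → ℕ → Finset ℕ) : Prop where
  nonempty_iff : ∀ i j, (e i j).Nonempty ↔ j < l i
  lt : ∀ i j, ∀ a ∈ e i j, a < m
  row : ∀ i j j', j < j' → ∀ a ∈ e i j, ∀ b ∈ e i j', a ≤ b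
  col : ∀ i i' j, i < i' → ∀ a ∈ e i j, ∀ b ∈ e i' j, a < b

lemma IsTableau.lt_of_mem {m : ℕ} {l : Fin m → ℕ} {e : Fin m → ℕ → Finset ℕ}
    (he : IsTableau l e) {i j a} (ha : a ∈ e i j) : j < l i :=
  (he.nonempty_iff i j).1 ⟨a, ha⟩

lemma IsTableau.eq_empty {m : ℕ} {l : Fin m → ℕ} {e : Fin m → ℕ → Finset ℕ}
    (he : IsTableau l e) {i j} (h : l i ≤ j) : e i j = ∅ := by
  rw [← Finset.not_nonempty_iff_eq_empty, he.nonempty_iff]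
  omega

lemma finite_setOf_isTableau {m : ℕ} (l : Fin m → ℕ) : {e | IsTableau l e}.Finite := by
  refine Set.Finite.of_finite_image (f := fun e (i : Fin m) (j : Fin (l i)) => e i j) ?_ ?_
  · have hfin : {g : (i : Fin m) → Fin (l i) → Finset ℕ |
        ∀ i, g i ∈ {h : Fin (l i) → Finset ℕ |
          ∀ j, h j ∈ ((Finset.range m).powerset : Set (Finset ℕ))}}.Finite :=
      Set.Finite.pi' fun i => Set.Finite.pi' fun _ => Finset.finite_toSet _
    refine hfin.subset ?_
    rintro _ ⟨e, he, rfl⟩ i j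
    simp only [Finset.mem_coe, Finset.mem_powerset]
    exact fun a ha => Finset.mem_range.2 (he.lt i j a ha)
  · intro e he e' he' hee
    ext i j : 2
    by_cases h : j < l i
    · exact congrFun (congrFun hee i) ⟨j, h⟩
    · rw [he.eq_empty (not_lt.1 h), he'.eq_empty (not_lt.1 h)]

/-- The finite set of all set-valued tableaux of shape `l`. -/
noncomputable def tableaux {m : ℕ} (l : Fin m → ℕ) : Finset (Fin m → ℕ → Finset ℕ) :=
  (finite_setOf_isTableau l).toFinset

@[simp] lemma mem_tableaux {m : ℕ} {l : Fin m → ℕ} {e : Fin m → ℕ → Finset ℕ} :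
    e ∈ tableaux l ↔ IsTableau l e := by
  simp [tableaux]

lemma IsTableau.le_entry {m : ℕ} {l : Fin m → ℕ} {e : Fin m → ℕ → Finset ℕ}
    (hl : Antitone l) (he : IsTableau l e) {i : Fin m} {j a : ℕ} (ha : a ∈ e i j) :
    (i : ℕ) ≤ a := by
  obtain ⟨m, rfl⟩ : ∃ m', m = m' + 1 := ⟨m - 1, by have := i.is_lt; omega⟩
  induction i using Fin.induction generalizing a with
  | zero => simp
  | succ i ih =>
    obtain ⟨b, hb⟩ := (he.nonempty_iff i.castSucc j).2
      ((he.lt_of_mem ha).trans_le (hl Fin.castSucc_lt_succ.le))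
    have h1 := ih hb
    have h2 := he.col _ _ j Fin.castSucc_lt_succ b hb a ha
    simp only [Fin.val_castSucc, Fin.val_succ] at h1 ⊢
    omega

/-- Extend a tableau `e` of shape `k` by the entry `m`: it fills the cells of `l / k` and is added
to the last cell of each row in `s`. -/
noncomputable def extendTableau {m : ℕ} (l : Fin (m + 1) → ℕ) (k : Fin m → ℕ)
    (s : Finset (Fin m)) (e : Fin m → ℕ → Finset ℕ) : Fin (m + 1) → ℕ → Finset ℕ :=
  Fin.snoc (α := fun _ => ℕ → Finset ℕ)
    (fun i j => e i j ∪
      if (k i ≤ j ∧ j < l i.castSucc) ∨ (i ∈ s ∧ j + 1 = k i) then {m} else ∅)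
    (fun j => if j < l (Fin.last m) then {m} else ∅)

section Extend

variable {m : ℕ} {l : Fin (m + 1) → ℕ} {k : Fin m → ℕ} {s : Finset (Fin m)}
  {e : Fin m → ℕ → Finset ℕ}

lemma extendTableau_castSucc (i : Fin m) (j : ℕ) :
    extendTableau l k s e i.castSucc j = e i j ∪
      if (k i ≤ j ∧ j < l i.castSucc) ∨ (i ∈ s ∧ j + 1 = k i) then {m} else ∅ := by
  simp [extendTableau]

lemma mem_extendTableau_castSucc {i : Fin m} {j a : ℕ} :
    a ∈ extendTableau l k s e i.castSucc j ↔
      a ∈ e i j ∨ (a = m ∧ ((k i ≤ j ∧ j < l i.castSucc) ∨ (i ∈ s ∧ j + 1 = k i))) := by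
  rw [extendTableau_castSucc, Finset.mem_union]
  split_ifs with h <;> simp [h]

lemma mem_extendTableau_last {j a : ℕ} :
    a ∈ extendTableau l k s e (Fin.last m) j ↔ a = m ∧ j < l (Fin.last m) := by
  simp only [extendTableau, Fin.snoc_last]
  split_ifs with h <;> simp [h]

lemma isTableau_extendTableau (hl : Antitone l)
    (hk : ∀ i : Fin m, l i.succ ≤ k i ∧ k i ≤ l i.castSucc) (hs : ∀ i ∈ s, l i.succ < k i)
    (he : IsTableau k e) : IsTableau l (extendTableau l k s e) := by
  have hne : ∀ i j, (extendTableau l k s e i j).Nonempty ↔ j < l i := by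
    intro i j
    induction i using Fin.lastCases with
    | last => exact ⟨fun ⟨a, ha⟩ => (mem_extendTableau_last.1 ha).2,
        fun h => ⟨m, mem_extendTableau_last.2 ⟨rfl, h⟩⟩⟩
    | cast i =>
      constructor
      · rintro ⟨a, ha⟩
        rw [mem_extendTableau_castSucc] at ha
        have := hk i
        rcases ha with ha | ⟨-, ha⟩
        · have := he.lt_of_mem ha
          omega
        · omega
      · intro h
        by_cases h' : j < k i
        · obtain ⟨a, ha⟩ := (he.nonempty_iff i j).2 h'
          exact ⟨a, mem_extendTableau_castSucc.2 (.inl ha)⟩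
        · exact ⟨m, mem_extendTableau_castSucc.2 (.inr ⟨rfl, .inl ⟨not_lt.1 h', h⟩⟩)⟩
  have hlt : ∀ i j, ∀ a ∈ extendTableau l k s e i j, a < m + 1 := by
    intro i j a ha
    induction i using Fin.lastCases with
    | last => rw [mem_extendTableau_last] at ha; omega
    | cast i =>
      rw [mem_extendTableau_castSucc] at ha
      rcases ha with ha | ⟨rfl, -⟩
      · have := he.lt i j a ha
        omega
      · omega
  refine ⟨hne, hlt, ?_, ?_⟩
  · intro i j j' hj a ha b hb
    induction i using Fin.lastCases with
    | last =>
      rw [mem_extendTableau_last] at ha hb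
      omega
    | cast i =>
      have h1 := hlt _ _ _ ha
      rw [mem_extendTableau_castSucc] at ha hb
      rcases hb with hb | ⟨rfl, -⟩
      · have := he.lt_of_mem hb
        rcases ha with ha | ⟨rfl, h⟩
        · exact he.row i j j' hj a ha b hb
        · omega
      · omega
  · intro i i' j hi a ha b hb
    obtain ⟨i, rfl⟩ := Fin.exists_castSucc_eq.2 (hi.trans_le (Fin.le_last i')).ne
    have h1 : j < l i.succ := ((hne _ _).1 ⟨b, hb⟩).trans_le (hl (Fin.castSucc_lt_iff_succ_le.1 hi))
    have h2 := hk i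
    rw [mem_extendTableau_castSucc] at ha
    rcases ha with ha | ⟨rfl, h | h⟩
    · induction i' using Fin.lastCases with
      | last =>
        rw [mem_extendTableau_last] at hb
        exact hb.1 ▸ he.lt _ _ _ ha
      | cast i' =>
        rw [mem_extendTableau_castSucc] at hb
        rcases hb with hb | ⟨rfl, -⟩
        · exact he.col i i' j (by simpa using hi) a ha b hb
        · exact he.lt _ _ _ ha
    · omega
    · have := hs i h.1
      omega

lemma exists_extendTableau_eq (hl : Antitone l) {E : Fin (m + 1) → ℕ → Finset ℕ}
    (hE : IsTableau l E) : ∃ k : Fin m → ℕ, (∀ i : Fin m, l i.succ ≤ k i ∧ k i ≤ l i.castSucc) ∧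
      ∃ s : Finset (Fin m), (∀ i ∈ s, l i.succ < k i) ∧
        ∃ e, IsTableau k e ∧ extendTableau l k s e = E := by
  classical
  have hk : ∀ i : Fin m, ∃ k, ∀ j, (∃ a ∈ E i.castSucc j, a < m) ↔ j < k := by
    intro i
    have hex : ∃ j, ¬ ∃ a ∈ E i.castSucc j, a < m :=
      ⟨l i.castSucc, fun ⟨a, ha, _⟩ => (hE.lt_of_mem ha).false⟩
    refine ⟨Nat.find hex, fun j => ⟨fun ⟨a, ha, ham⟩ => ?_, fun h => ?_⟩⟩
    · by_contra h
      replace h := not_lt.1 h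
      refine Nat.find_spec hex ?_
      rcases h.eq_or_lt with h | h
      · exact ⟨a, by rwa [h], ham⟩
      · obtain ⟨b, hb⟩ := (hE.nonempty_iff i.castSucc (Nat.find hex)).2 (h.trans (hE.lt_of_mem ha))
        exact ⟨b, hb, (hE.row _ _ _ h b hb a ha).trans_lt ham⟩
    · exact not_not.1 (Nat.find_min hex h)
  choose k hk using hk
  have hkl : ∀ i : Fin m, l i.succ ≤ k i ∧ k i ≤ l i.castSucc := by
    intro i
    constructor
    · by_contra! h
      obtain ⟨b, hb⟩ := (hE.nonempty_iff i.succ (k i)).2 h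
      obtain ⟨a, ha⟩ := (hE.nonempty_iff i.castSucc (k i)).2
        (h.trans_le (hl Fin.castSucc_lt_succ.le))
      have h1 := hE.col _ _ _ Fin.castSucc_lt_succ a ha b hb
      have h2 := hE.lt _ _ _ hb
      exact ((hk i (k i)).1 ⟨a, ha, by omega⟩).false
    · by_contra! h
      obtain ⟨a, ha, -⟩ := (hk i _).2 h
      exact (hE.lt_of_mem ha).false
  have hlast : ∀ {i j}, k i ≤ j → ∀ a ∈ E i.castSucc j, a = m := by
    intro i j h a ha
    have h1 := hE.lt _ _ _ ha
    by_contra h2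
    have := (hk i j).1 ⟨a, ha, by omega⟩
    omega
  refine ⟨k, hkl, Finset.univ.filter fun i => 0 < k i ∧ m ∈ E i.castSucc (k i - 1), ?_,
    fun i j => (E i.castSucc j).filter (· < m), ⟨?_, ?_, ?_, ?_⟩, ?_⟩
  · intro i hi
    simp only [Finset.mem_filter, Finset.mem_univ, true_and] at hi
    by_contra! h
    obtain ⟨b, hb⟩ := (hE.nonempty_iff i.succ (k i - 1)).2 (by omega)
    have h1 := hE.col _ _ _ Fin.castSucc_lt_succ m hi.2 b hb
    have h2 := hE.lt _ _ _ hb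
    omega
  · intro i j
    rw [← hk]
    simp [Finset.Nonempty]
  · intro i j a ha
    exact (Finset.mem_filter.1 ha).2
  · intro i j j' hj a ha b hb
    exact hE.row _ _ _ hj a (Finset.mem_filter.1 ha).1 b (Finset.mem_filter.1 hb).1
  · intro i i' j hi a ha b hb
    exact hE.col _ _ _ (by simpa using hi) a (Finset.mem_filter.1 ha).1 b (Finset.mem_filter.1 hb).1
  · ext i j a
    induction i using Fin.lastCases with
    | last =>
      rw [mem_extendTableau_last]
      have key : ∀ b ∈ E (Fin.last m) j, b = m := by
        intro b hb
        have h1 := hE.le_entry hl hb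
        have h2 := hE.lt _ _ _ hb
        simp only [Fin.val_last] at h1
        omega
      constructor
      · rintro ⟨rfl, h⟩
        obtain ⟨b, hb⟩ := (hE.nonempty_iff _ _).2 h
        exact key b hb ▸ hb
      · exact fun h => ⟨key a h, hE.lt_of_mem h⟩
    | cast i =>
      rw [mem_extendTableau_castSucc]
      simp only [Finset.mem_filter, Finset.mem_univ, true_and]
      constructor
      · rintro (⟨h, -⟩ | ⟨rfl, ⟨h1, h2⟩ | ⟨⟨h1, h2⟩, h3⟩⟩)
        · exact h
        · obtain ⟨b, hb⟩ := (hE.nonempty_iff _ _).2 h2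
          exact hlast h1 b hb ▸ hb
        · rwa [← h3] at h2
      · intro ha
        have h1 := hE.lt _ _ _ ha
        by_cases h2 : a < m
        · exact .inl ⟨ha, h2⟩
        obtain rfl : a = m := by omega
        refine .inr ⟨rfl, ?_⟩
        by_cases h3 : k i ≤ j
        · exact .inl ⟨h3, hE.lt_of_mem ha⟩
        · have h4 : j + 1 = k i := by
            by_contra h4
            obtain ⟨b, hb, hbm⟩ := (hk i (j + 1)).2 (by omega)
            have := hE.row _ _ _ (Nat.lt_succ_self j) _ ha b hb
            omega
          exact .inr ⟨⟨by omega, by rwa [← h4]⟩, h4⟩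

lemma extendTableau_injective {k' : Fin m → ℕ} {s' : Finset (Fin m)}
    {e' : Fin m → ℕ → Finset ℕ} (hs : ∀ i ∈ s, l i.succ < k i) (hs' : ∀ i ∈ s', l i.succ < k' i)
    (he : IsTableau k e) (he' : IsTableau k' e')
    (h : extendTableau l k s e = extendTableau l k' s' e') : k = k' ∧ s = s' ∧ e = e' := by
  have key : ∀ i j a, (a ∈ e i j ∨
      (a = m ∧ ((k i ≤ j ∧ j < l i.castSucc) ∨ (i ∈ s ∧ j + 1 = k i)))) ↔ (a ∈ e' i j ∨
      (a = m ∧ ((k' i ≤ j ∧ j < l i.castSucc) ∨ (i ∈ s' ∧ j + 1 = k' i)))) := by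
    intro i j a
    rw [← mem_extendTableau_castSucc, h, mem_extendTableau_castSucc]
  have hee : e = e' := by
    ext i j a
    have h1 := key i j a
    constructor
    · intro ha
      have := he.lt _ _ _ ha
      exact (h1.1 (.inl ha)).resolve_right (by omega)
    · intro ha
      have := he'.lt _ _ _ ha
      exact (h1.2 (.inl ha)).resolve_right (by omega)
  subst hee
  have hkk : k = k' := by
    ext i
    have h1 := fun j => (he.nonempty_iff i j).symm.trans (he'.nonempty_iff i j)
    exact le_antisymm (not_lt.1 fun h => ((h1 _).1 h).false) (not_lt.1 fun h => ((h1 _).2 h).false)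
  subst hkk
  refine ⟨rfl, ?_, rfl⟩
  ext i
  have h1 := key i (k i - 1) m
  have h2 : m ∉ e i (k i - 1) := fun h => (he.lt _ _ _ h).false
  constructor
  · intro h
    have h3 := hs i h
    rcases (h1.1 (.inr ⟨rfl, .inr ⟨h, by omega⟩⟩)).resolve_left h2 with ⟨-, h4 | h4⟩
    · omega
    · exact h4.1
  · intro h
    have h3 := hs' i h
    rcases (h1.2 (.inr ⟨rfl, .inr ⟨h, by omega⟩⟩)).resolve_left h2 with ⟨-, h4 | h4⟩
    · omega
    · exact h4.1

end Extend

variable {R : Type*} [CommRing R]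

/-- The contribution of a single cell with set of entries `s`. -/
def cellWeight (x : ℕ → R) (t : R) (s : Finset ℕ) : R := t ^ (s.card - 1) * ∏ a ∈ s, x a

/-- The product of the weights of all cells of a tableau. -/
def tableauWeight (x : ℕ → R) (t : R) {m : ℕ} (l : Fin m → ℕ) (e : Fin m → ℕ → Finset ℕ) : R :=
  ∏ i, ∏ j ∈ Finset.range (l i), cellWeight x t (e i j)

/-- The generating function of the set-valued tableaux of shape `l`, where `t` marks the excess of
the sizes of the entries over the number of cells. -/
noncomputable def tableauSum (x : ℕ → R) (t : R) {m : ℕ} (l : Fin m → ℕ) : R :=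
  ∑ e ∈ tableaux l, tableauWeight x t l e

lemma cellWeight_singleton (x : ℕ → R) (t : R) (a : ℕ) : cellWeight x t {a} = x a := by
  simp [cellWeight]

lemma cellWeight_union_singleton (x : ℕ → R) (t : R) {s : Finset ℕ} {a : ℕ} (ha : a ∉ s)
    (hs : s.Nonempty) : cellWeight x t (s ∪ {a}) = cellWeight x t s * (t * x a) := by
  have := hs.card_pos
  rw [cellWeight, cellWeight, Finset.union_comm, ← Finset.insert_eq, Finset.card_insert_of_notMem ha,
    Finset.prod_insert ha, Nat.add_sub_cancel, show s.card = s.card - 1 + 1 by omega, pow_succ]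
  simp only [Nat.add_sub_cancel]
  ring

lemma tableauWeight_extendTableau (x : ℕ → R) (t : R) {m : ℕ} {l : Fin (m + 1) → ℕ} {k : Fin m → ℕ}
    {s : Finset (Fin m)} {e : Fin m → ℕ → Finset ℕ} (hk : ∀ i : Fin m, k i ≤ l i.castSucc)
    (hs : ∀ i ∈ s, 0 < k i) (he : IsTableau k e) :
    tableauWeight x t l (extendTableau l k s e) =
      x m ^ l (Fin.last m) * ((∏ i : Fin m, x m ^ (l i.castSucc - k i)) *
        (∏ _i ∈ s, t * x m) * tableauWeight x t k e) := by
  have hlast : ∏ j ∈ Finset.range (l (Fin.last m)),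
      cellWeight x t (extendTableau l k s e (Fin.last m) j) = x m ^ l (Fin.last m) := by
    rw [Finset.prod_congr rfl (g := fun _ => x m), Finset.prod_const, Finset.card_range]
    intro j hj
    rw [Finset.mem_range] at hj
    simp [extendTableau, hj, cellWeight_singleton]
  have hrow : ∀ i : Fin m, ∏ j ∈ Finset.range (l i.castSucc),
      cellWeight x t (extendTableau l k s e i.castSucc j) =
      x m ^ (l i.castSucc - k i) * (if i ∈ s then t * x m else 1) *
        ∏ j ∈ Finset.range (k i), cellWeight x t (e i j) := by
    intro i
    rw [← Finset.prod_range_mul_prod_Ico _ (hk i), Finset.prod_congr rfl (s₁ := Finset.Ico _ _)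
      (g := fun _ => x m), Finset.prod_const, Nat.card_Ico, mul_comm, mul_assoc]
    · congr 1
      split_ifs with h
      · have h0 := hs i h
        obtain ⟨c, hc⟩ : ∃ c, k i = c + 1 := ⟨k i - 1, by omega⟩
        rw [hc, Finset.prod_range_succ, Finset.prod_range_succ]
        have h1 : ∀ j ∈ Finset.range c, cellWeight x t (extendTableau l k s e i.castSucc j) =
            cellWeight x t (e i j) := by
          intro j hj
          rw [Finset.mem_range] at hj
          rw [extendTableau_castSucc, if_neg (by omega), Finset.union_empty]
        rw [Finset.prod_congr rfl h1, extendTableau_castSucc, if_pos (.inr ⟨h, hc.symm⟩),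
          cellWeight_union_singleton _ _ (fun h => (he.lt _ _ _ h).false)
            ((he.nonempty_iff _ _).2 (by omega))]
        ring
      · rw [one_mul]
        refine Finset.prod_congr rfl fun j hj => ?_
        rw [Finset.mem_range] at hj
        rw [extendTableau_castSucc, if_neg, Finset.union_empty]
        rintro (h' | h')
        · omega
        · exact h h'.1
    · intro j hj
      rw [Finset.mem_Ico] at hj
      rw [extendTableau_castSucc, if_pos (.inl hj), he.eq_empty hj.1, Finset.empty_union,
        cellWeight_singleton]
  rw [tableauWeight, Fin.prod_univ_castSucc, hlast, Finset.prod_congr rfl fun _ _ => hrow _,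
    Finset.prod_mul_distrib, Finset.prod_mul_distrib, Finset.prod_ite_mem, Finset.univ_inter,
    mul_comm]
  rfl

lemma tableauSum_succ (x : ℕ → R) (t : R) {m : ℕ} {l : Fin (m + 1) → ℕ} (hl : Antitone l) :
    tableauSum x t l = x m ^ l (Fin.last m) *
      ∑ k ∈ Fintype.piFinset fun i : Fin m => Finset.Icc (l i.succ) (l i.castSucc),
        (∏ i, stepWeight (x m) t (l i.succ) (l i.castSucc) (k i)) * tableauSum x t k := by
  classical
  have h1 : ∀ k : Fin m → ℕ, ∏ i : Fin m, stepWeight (x m) t (l i.succ) (l i.castSucc) (k i) =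
      ∑ s ∈ (Finset.univ.filter fun i : Fin m => l i.succ < k i).powerset,
        (∏ i : Fin m, x m ^ (l i.castSucc - k i)) * ∏ _i ∈ s, t * x m := by
    intro k
    simp only [stepWeight]
    rw [Finset.prod_mul_distrib, ← Finset.prod_filter, Finset.prod_one_add, Finset.mul_sum]
  simp only [h1, tableauSum, Finset.sum_mul_sum]
  simp only [Finset.mul_sum, Finset.sum_sigma']
  symm
  refine Finset.sum_bij (fun a _ => extendTableau l a.1 a.2.1 a.2.2) ?_ ?_ ?_ ?_
  · rintro ⟨k, s, e⟩ h
    simp only [Finset.mem_sigma, Fintype.mem_piFinset, Finset.mem_Icc,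
      Finset.mem_powerset, mem_tableaux] at h
    exact mem_tableaux.2 (isTableau_extendTableau hl h.1
      (fun i hi => (Finset.mem_filter.1 (h.2.1 hi)).2) h.2.2)
  · rintro ⟨k, s, e⟩ h ⟨k', s', e'⟩ h' heq
    simp only [Finset.mem_sigma, Fintype.mem_piFinset, Finset.mem_Icc,
      Finset.mem_powerset, mem_tableaux] at h h'
    obtain ⟨rfl, rfl, rfl⟩ := extendTableau_injective
      (fun i hi => (Finset.mem_filter.1 (h.2.1 hi)).2)
      (fun i hi => (Finset.mem_filter.1 (h'.2.1 hi)).2) h.2.2 h'.2.2 heq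
    rfl
  · intro E hE
    obtain ⟨k, hk, s, hs, e, he, rfl⟩ := exists_extendTableau_eq hl (mem_tableaux.1 hE)
    refine ⟨⟨k, s, e⟩, ?_, rfl⟩
    simp only [Finset.mem_sigma, Fintype.mem_piFinset, Finset.mem_Icc,
      Finset.mem_powerset, mem_tableaux]
    exact ⟨hk, fun i hi => by simpa using hs i hi, he⟩
  · rintro ⟨k, s, e⟩ h
    simp only [Finset.mem_sigma, Fintype.mem_piFinset, Finset.mem_Icc,
      Finset.mem_powerset, mem_tableaux] at h
    rw [tableauWeight_extendTableau x t (fun i => (h.1 i).2) (fun i hi => ?_) h.2.2]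
    have := (Finset.mem_filter.1 (h.2.1 hi)).2
    omega

theorem prod_sub_mul_tableauSum [IsDomain R] (x : ℕ → R) (t : R) (hx : ∀ i, 1 + t * x i ≠ 0)
    {m : ℕ} (l : Fin m → ℕ) (hl : Antitone l) :
    (∏ p ∈ Finset.range m, ∏ i ∈ Finset.range p, (x i - x p)) * tableauSum x t l =
      powerDet x t (fun j => (j : ℕ)) l := by
  induction m with
  | zero =>
    have h1 : tableaux l = {fun _ _ => ∅} := by
      ext e
      rw [mem_tableaux, Finset.mem_singleton]
      exact ⟨fun _ => Subsingleton.elim _ _,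
        fun _ => ⟨fun i => i.elim0, fun i => i.elim0, fun i => i.elim0, fun i => i.elim0⟩⟩
    simp [tableauSum, h1, tableauWeight, powerDet]
  | succ m ih =>
    have key : (∏ p ∈ Finset.range m, ∏ i ∈ Finset.range p, (x i - x p)) *
        ∑ k ∈ Fintype.piFinset fun i : Fin m => Finset.Icc (l i.succ) (l i.castSucc),
          (∏ i, stepWeight (x m) t (l i.succ) (l i.castSucc) (k i)) * tableauSum x t k =
        ∑ k ∈ Fintype.piFinset fun i : Fin m => Finset.Icc (l i.succ) (l i.castSucc),
          (∏ i, stepWeight (x m) t (l i.succ) (l i.castSucc) (k i)) *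
            powerDet x t (fun j => (j : ℕ)) k := by
      rw [Finset.mul_sum]
      refine Finset.sum_congr rfl fun k hk => ?_
      simp only [Fintype.mem_piFinset, Finset.mem_Icc] at hk
      rw [← ih k, mul_left_comm]
      intro i i' h
      rcases h.eq_or_lt with rfl | h
      · exact le_rfl
      · exact (hk i').2.trans ((hl (Fin.succ_le_castSucc_iff.2 h)).trans (hk i).1)
    rw [powerDet_branching x t l (fun i => hl Fin.castSucc_lt_succ.le) (hx m),
      tableauSum_succ x t hl, Finset.prod_range_succ, ← key]
    ring

end Tableau

section Bridge

lemma YoungDiagram.mem_cells_iff_of_colLen_le {μ : YoungDiagram} {m : ℕ} (h : μ.colLen 0 ≤ m)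
    (c : ℕ × ℕ) : c ∈ μ.cells ↔ c.1 ∈ Finset.range m ∧ c.2 ∈ Finset.range (μ.rowLen c.1) := by
  obtain ⟨i, j⟩ := c
  rw [YoungDiagram.mem_cells, Finset.mem_range, Finset.mem_range, ← YoungDiagram.mem_iff_lt_rowLen]
  exact (and_iff_right_of_imp fun hc => (YoungDiagram.mem_iff_lt_colLen.1
    (μ.up_left_mem le_rfl (Nat.zero_le j) hc)).trans_le h).symm

/-- The lengths of the first `m` rows of a Young diagram. -/
def YoungDiagram.rows (μ : YoungDiagram) (m : ℕ) : Fin m → ℕ := fun i => μ.rowLen i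

lemma YoungDiagram.rows_antitone (μ : YoungDiagram) (m : ℕ) : Antitone (μ.rows m) :=
  fun _ _ h => μ.rowLen_anti _ _ h

lemma YoungDiagram.prod_cells {M : Type*} [CommMonoid M] {μ : YoungDiagram} {m : ℕ}
    (h : μ.colLen 0 ≤ m) (F : ℕ × ℕ → M) :
    ∏ c ∈ μ.cells, F c = ∏ i : Fin m, ∏ j ∈ Finset.range (μ.rows m i), F (i, j) := by
  rw [Finset.prod_finset_product _ (Finset.range m) (fun i => Finset.range (μ.rowLen i))
    (YoungDiagram.mem_cells_iff_of_colLen_le h),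
    Finset.prod_range]
  rfl

lemma YoungDiagram.card_eq_sum_rows {μ : YoungDiagram} {m : ℕ} (h : μ.colLen 0 ≤ m) :
    μ.card = ∑ i, μ.rows m i := by
  rw [YoungDiagram.card, Finset.card_eq_sum_ones,
    Finset.sum_finset_product _ (Finset.range m) (fun i => Finset.range (μ.rowLen i))
    (YoungDiagram.mem_cells_iff_of_colLen_le h),
    Finset.sum_range]
  simp [YoungDiagram.rows]

namespace SVT

variable {μ : YoungDiagram} (T : SVT μ.cells)

lemma mem_of_mem_entry {T : SVT μ.cells} {c : ℕ × ℕ} {a : ℕ} (h : a ∈ T.entry c) :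
    c ∈ μ := by
  by_contra hc
  rw [T.eq_empty_of_not_mem c hc] at h
  simp at h

lemma row_le (i : ℕ) {j j' : ℕ} (hj : j < j') {a b : ℕ} (ha : a ∈ T.entry (i, j))
    (hb : b ∈ T.entry (i, j')) : a ≤ b := by
  induction j', hj using Nat.le_induction generalizing b with
  | base => exact T.row_weak i j (mem_of_mem_entry ha) (mem_of_mem_entry hb) a ha b hb
  | succ j' _ ih =>
    have h1 := mem_of_mem_entry hb
    have h2 : (i, j') ∈ μ := μ.up_left_mem le_rfl (Nat.le_succ j') h1
    obtain ⟨c, hc⟩ := T.nonempty_of_mem _ h2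
    exact (ih hc).trans (T.row_weak i j' h2 h1 c hc b hb)

lemma col_lt {i i' : ℕ} (j : ℕ) (hi : i < i') {a b : ℕ} (ha : a ∈ T.entry (i, j))
    (hb : b ∈ T.entry (i', j)) : a < b := by
  induction i', hi using Nat.le_induction generalizing b with
  | base => exact T.col_strict i j (mem_of_mem_entry ha) (mem_of_mem_entry hb) a ha b hb
  | succ i' _ ih =>
    have h1 := mem_of_mem_entry hb
    have h2 : (i', j) ∈ μ := μ.up_left_mem (Nat.le_succ i') le_rfl h1
    obtain ⟨c, hc⟩ := T.nonempty_of_mem _ h2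
    exact (ih hc).trans (T.col_strict i' j h2 h1 c hc b hb)

lemma row_index_le {i j a : ℕ} (ha : a ∈ T.entry (i, j)) : i ≤ a := by
  induction i generalizing a with
  | zero => exact Nat.zero_le a
  | succ i ih =>
    obtain ⟨b, hb⟩ := T.nonempty_of_mem _
      (μ.up_left_mem (Nat.le_succ i) le_rfl (mem_of_mem_entry ha))
    exact (ih hb).trans_lt (T.col_lt j (Nat.lt_succ_self i) hb ha)

lemma colLen_le_of_bounded {T : SVT μ.cells} {m : ℕ} (hT : T.Bounded m) : μ.colLen 0 ≤ m := by
  by_contra! h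
  obtain ⟨a, ha⟩ := T.nonempty_of_mem _ (YoungDiagram.mem_iff_lt_colLen.2 h)
  exact ((T.row_index_le ha).trans_lt (hT _ _ ha)).false

/-- The entries of the first `m` rows of a set-valued tableau. -/
def rows (m : ℕ) : Fin m → ℕ → Finset ℕ := fun i j => T.entry (i, j)

lemma isTableau_rows {T : SVT μ.cells} {m : ℕ} (hT : T.Bounded m) :
    IsTableau (μ.rows m) (T.rows m) where
  nonempty_iff i j := by
    rw [YoungDiagram.rows, ← YoungDiagram.mem_iff_lt_rowLen]
    exact ⟨fun ⟨_, ha⟩ => mem_of_mem_entry ha, T.nonempty_of_mem _⟩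
  lt i j := hT _
  row i _ _ hj _ ha _ hb := T.row_le i hj ha hb
  col _ _ j hi _ ha _ hb := T.col_lt j hi ha hb

lemma bijOn_rows {m : ℕ} (h : μ.colLen 0 ≤ m) :
    Set.BijOn (fun T : SVT μ.cells => T.rows m) {T | T.Bounded m} ↑(tableaux (μ.rows m)) := by
  refine ⟨fun T hT => Finset.mem_coe.2 (mem_tableaux.2 (isTableau_rows hT)), ?_, ?_⟩
  · intro T hT T' hT' hTT
    have : T.entry = T'.entry := by
      funext ⟨i, j⟩
      by_cases hi : i < m
      · exact congrFun (congrFun hTT ⟨i, hi⟩) j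
      · have hc : (i, j) ∉ μ.cells := fun hc =>
          hi (Finset.mem_range.1 ((YoungDiagram.mem_cells_iff_of_colLen_le h _).1 hc).1)
        rw [T.eq_empty_of_not_mem _ hc, T'.eq_empty_of_not_mem _ hc]
    cases T
    cases T'
    congr
  · intro e he
    rw [Finset.mem_coe, mem_tableaux] at he
    have hcells : ∀ i j, (i, j) ∈ μ.cells → ∃ hi : i < m, j < μ.rows m ⟨i, hi⟩ := by
      intro i j hc
      rw [YoungDiagram.mem_cells_iff_of_colLen_le h, Finset.mem_range, Finset.mem_range] at hc
      exact ⟨hc.1, hc.2⟩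
    refine ⟨⟨fun c => if hi : c.1 < m then e ⟨c.1, hi⟩ c.2 else ∅, ?_, ?_, ?_, ?_⟩, ?_, ?_⟩
    · rintro ⟨i, j⟩ hc
      obtain ⟨hi, hj⟩ := hcells i j hc
      simpa [hi] using (he.nonempty_iff ⟨i, hi⟩ j).2 hj
    · rintro ⟨i, j⟩ hc
      split_ifs with hi
      · refine he.eq_empty (not_lt.1 fun hj => hc ?_)
        exact YoungDiagram.mem_iff_lt_rowLen.2 hj
      · rfl
    · intro i j hc hc'
      obtain ⟨hi, -⟩ := hcells i j hc
      simpa [hi] using he.row ⟨i, hi⟩ j (j + 1) (Nat.lt_succ_self j)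
    · intro i j hc hc'
      obtain ⟨hi, -⟩ := hcells _ _ hc
      obtain ⟨hi', -⟩ := hcells _ _ hc'
      simpa [hi, hi'] using he.col ⟨i, hi⟩ ⟨i + 1, hi'⟩ j (Nat.lt_succ_self i)
    · rintro ⟨i, j⟩ a ha
      by_cases hi : i < m
      · simp only [hi, dif_pos] at ha
        exact he.lt _ _ a ha
      · simp [hi] at ha
    · funext i j
      simp [SVT.rows]

lemma card_pos {T : SVT μ.cells} {c : ℕ × ℕ} (hc : c ∈ μ.cells) : 1 ≤ (T.entry c).card :=
  (T.nonempty_of_mem c hc).card_pos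

lemma size_sub_card : T.size - μ.cells.card = ∑ c ∈ μ.cells, ((T.entry c).card - 1) := by
  rw [Finset.sum_tsub_distrib _ fun c hc => card_pos hc, ← Finset.card_eq_sum_ones]
  rfl

lemma tableauWeight_rows {m : ℕ} (h : μ.colLen 0 ≤ m) (t : MvPolynomial ℕ ℤ) :
    tableauWeight X t (μ.rows m) (T.rows m) = t ^ (T.size - μ.cells.card) * T.monomial := by
  rw [size_sub_card, SVT.monomial, ← Finset.prod_pow_eq_pow_sum, ← Finset.prod_mul_distrib,
    YoungDiagram.prod_cells h]
  rfl

lemma finsum_mem_bounded {m : ℕ} (h : μ.colLen 0 ≤ m) (t : MvPolynomial ℕ ℤ) :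
    ∑ᶠ (T : SVT μ.cells) (_ : T.Bounded m), t ^ (T.size - μ.cells.card) * T.monomial =
      tableauSum X t (μ.rows m) := by
  rw [tableauSum, ← finsum_mem_coe_finset]
  exact finsum_mem_eq_of_bijOn _ (bijOn_rows h) fun T _ => (T.tableauWeight_rows h t).symm

end SVT

lemma grothendieck_eq_tableauSum {μ : YoungDiagram} {m : ℕ} (h : μ.colLen 0 ≤ m) :
    grothendieck μ.cells m = tableauSum X (-1) (μ.rows m) := by
  rw [← SVT.finsum_mem_bounded h, grothendieck]
  simp [zsmul_eq_mul]

lemma schurPoly_eq_tableauSum {μ : YoungDiagram} {m : ℕ} (h : μ.colLen 0 ≤ m) :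
    schurPoly μ m = tableauSum X 0 (μ.rows m) := by
  rw [← SVT.finsum_mem_bounded h, schurPoly]
  refine finsum_congr fun T => ?_
  by_cases hT : T.Bounded m
  · have hiff : T.size - μ.cells.card = 0 ↔ ∀ c ∈ μ.cells, (T.entry c).card = 1 := by
      rw [T.size_sub_card, Finset.sum_eq_zero_iff]
      refine forall₂_congr fun c hc => ?_
      have := SVT.card_pos (T := T) hc
      omega
    simp only [hT, true_and, finsum_true, ← hiff]
    by_cases h0 : T.size - μ.cells.card = 0 <;> simp [h0]
  · simp [hT]

lemma YoungDiagram.mem_cells_sdiff_iff {lam μ : YoungDiagram} {i j : ℕ} :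
    (i, j) ∈ μ.cells \ lam.cells ↔ lam.rowLen i ≤ j ∧ j < μ.rowLen i := by
  rw [Finset.mem_sdiff, YoungDiagram.mem_cells, YoungDiagram.mem_cells,
    YoungDiagram.mem_iff_lt_rowLen, YoungDiagram.mem_iff_lt_rowLen, not_lt, and_comm]

lemma YoungDiagram.le_iff_rowLen_le_s12 {lam μ : YoungDiagram} :
    lam ≤ μ ↔ ∀ i, lam.rowLen i ≤ μ.rowLen i := by
  constructor
  · intro h i
    by_contra! hlt
    exact (YoungDiagram.mem_iff_lt_rowLen.1 (h (YoungDiagram.mem_iff_lt_rowLen.2 hlt))).false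
  · rintro h ⟨i, j⟩ hc
    exact YoungDiagram.mem_iff_lt_rowLen.2 ((YoungDiagram.mem_iff_lt_rowLen.1 hc).trans_le (h i))

lemma gCoeff_eq_card_fillings {lam μ : YoungDiagram} {m : ℕ} (hle : lam ≤ μ)
    (h : μ.colLen 0 ≤ m) : gCoeff lam μ = (fillings m (lam.rows m) (μ.rows m)).card := by
  have hlt : ∀ {i j}, (i, j) ∈ μ.cells \ lam.cells → i < m := fun hc =>
    Finset.mem_range.1 ((YoungDiagram.mem_cells_iff_of_colLen_le h _).1
      (Finset.mem_sdiff.1 hc).1).1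
  have key : Set.BijOn (fun (f : ℕ × ℕ → ℕ) (i : Fin m) j => f (i, j))
      {f : ℕ × ℕ → ℕ |
        (∀ c ∈ μ.cells \ lam.cells, 1 ≤ f c ∧ f c ≤ c.1) ∧
        (∀ c ∉ μ.cells \ lam.cells, f c = 0) ∧
        (∀ i j, (i, j) ∈ μ.cells \ lam.cells → (i, j + 1) ∈ μ.cells \ lam.cells →
          f (i, j) < f (i, j + 1)) ∧
        (∀ i j, (i, j) ∈ μ.cells \ lam.cells → (i + 1, j) ∈ μ.cells \ lam.cells →
          f (i, j) < f (i + 1, j))} ↑(fillings m (lam.rows m) (μ.rows m)) := by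
    refine ⟨?_, ?_, ?_⟩
    · rintro f ⟨hb, h0, hr, hc⟩
      refine Finset.mem_coe.2 (mem_fillings.2 ⟨fun i => ?_, ?_, ?_, ?_, ?_⟩)
      · exact YoungDiagram.le_iff_rowLen_le_s12.1 hle i
      · intro i j h1 h2
        have h3 := hb (i, j) (YoungDiagram.mem_cells_sdiff_iff.2 ⟨h1, h2⟩)
        exact ⟨h3.1, h3.2, by have := i.is_lt; dsimp only; omega⟩
      · exact fun i j hij => h0 _ fun hc => hij (YoungDiagram.mem_cells_sdiff_iff.1 hc)
      · intro i j j' h1 h2 h3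
        induction j', h2 using Nat.le_induction with
        | base =>
          exact hr i j (YoungDiagram.mem_cells_sdiff_iff.2 ⟨h1, (Nat.lt_succ_self j).trans h3⟩)
            (YoungDiagram.mem_cells_sdiff_iff.2 ⟨h1.trans (Nat.le_succ j), h3⟩)
        | succ j' hj' ih =>
          have h4 : lam.rowLen i ≤ j' := h1.trans (by omega)
          exact (ih ((Nat.lt_succ_self j').trans h3)).trans (hr i j'
            (YoungDiagram.mem_cells_sdiff_iff.2 ⟨h4, (Nat.lt_succ_self j').trans h3⟩)
            (YoungDiagram.mem_cells_sdiff_iff.2 ⟨h4.trans (Nat.le_succ j'), h3⟩))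
      · intro i i' j hi h1 h2
        obtain ⟨i, _⟩ := i
        obtain ⟨i', _⟩ := i'
        simp only [YoungDiagram.rows, Fin.mk_lt_mk] at hi h1 h2 ⊢
        have step : ∀ a, i ≤ a → a + 1 ≤ i' → f (a, j) + 1 ≤ f (a + 1, j) := by
          intro a h3 h4
          exact hc a j
            (YoungDiagram.mem_cells_sdiff_iff.2
              ⟨(lam.rowLen_anti _ _ h3).trans h1, h2.trans_le (μ.rowLen_anti _ _ (by omega))⟩)
            (YoungDiagram.mem_cells_sdiff_iff.2
              ⟨(lam.rowLen_anti _ _ (by omega)).trans h1, h2.trans_le (μ.rowLen_anti _ _ h4)⟩)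
        have all : ∀ a, i ≤ a → a ≤ i' → f (i, j) + a ≤ f (a, j) + i := by
          intro a ha
          induction a, ha using Nat.le_induction with
          | base => exact fun _ => le_rfl
          | succ a ha ih =>
            intro h3
            have := ih (by omega)
            have := step a ha h3
            omega
        exact all i' hi.le le_rfl
    · rintro f hf g hg hfg
      funext ⟨i, j⟩
      by_cases hi : i < m
      · exact congrFun (congrFun hfg ⟨i, hi⟩) j
      · rw [hf.2.1 _ fun hc => hi (hlt hc), hg.2.1 _ fun hc => hi (hlt hc)]
    · intro g hg
      rw [Finset.mem_coe, mem_fillings] at hg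
      refine ⟨fun c => if hi : c.1 < m then g ⟨c.1, hi⟩ c.2 else 0, ⟨?_, ?_, ?_, ?_⟩, ?_⟩
      · rintro ⟨i, j⟩ hc
        have hb := YoungDiagram.mem_cells_sdiff_iff.1 hc
        have := hg.bounds ⟨i, hlt hc⟩ j hb.1 hb.2
        simpa [hlt hc] using ⟨this.1, this.2.1⟩
      · rintro ⟨i, j⟩ hc
        rw [YoungDiagram.mem_cells_sdiff_iff] at hc
        dsimp only
        split_ifs with hi
        · exact hg.eq_zero ⟨i, hi⟩ j hc
        · rfl
      · intro i j hc hc'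
        simpa [hlt hc] using hg.row ⟨i, hlt hc⟩ j (j + 1) (YoungDiagram.mem_cells_sdiff_iff.1 hc).1
          (Nat.lt_succ_self j) (YoungDiagram.mem_cells_sdiff_iff.1 hc').2
      · intro i j hc hc'
        have := hg.col ⟨i, hlt hc⟩ ⟨i + 1, hlt hc'⟩ j (Nat.lt_succ_self i)
          (YoungDiagram.mem_cells_sdiff_iff.1 hc).1 (YoungDiagram.mem_cells_sdiff_iff.1 hc').2
        simp only [hlt hc, hlt hc', dif_pos]
        dsimp only at this
        omega
      · funext i j
        simp
  exact (Nat.card_congr (key.equiv _)).trans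
    ((Nat.card_coe_set_eq _).trans (Set.ncard_coe_finset _))

lemma IsFilling.le_add {K m : ℕ} {l n : Fin m → ℕ} {f : Fin m → ℕ → ℕ} (hf : IsFilling K l n f)
    (i : Fin m) : n i ≤ l i + i := by
  have key : ∀ k, l i + k < n i → k + 1 ≤ f i (l i + k) := by
    intro k
    induction k with
    | zero => exact fun h => (hf.bounds i _ (by omega) h).1
    | succ k ih =>
      intro h
      exact (ih (by omega)).trans_lt (hf.row i _ _ (by omega) (by omega) h)
  by_contra! h
  have h1 := key i h
  have h2 := (hf.bounds i _ (Nat.le_add_right _ _) h).2.1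
  omega

lemma YoungDiagram.bijOn_rows {lam : YoungDiagram} {m : ℕ} (hlam : lam.colLen 0 ≤ m) :
    Set.BijOn (fun μ : YoungDiagram => μ.rows m) {μ | lam ≤ μ ∧ μ.colLen 0 ≤ m}
      {n | Antitone n ∧ ∀ i, lam.rows m i ≤ n i} := by
  refine ⟨fun μ hμ => ⟨μ.rows_antitone m, fun i => le_iff_rowLen_le_s12.1 hμ.1 i⟩, ?_, ?_⟩
  · intro μ hμ ν hν hμν
    ext ⟨i, j⟩
    rw [mem_cells_iff_of_colLen_le hμ.2, mem_cells_iff_of_colLen_le hν.2]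
    refine and_congr_right fun hi => ?_
    rw [show μ.rowLen i = ν.rowLen i from congrFun hμν ⟨i, Finset.mem_range.1 hi⟩]
  · rintro n ⟨hn, hle⟩
    have hsorted : (List.ofFn n).SortedGE := List.sortedGE_ofFn_iff.2 hn
    have hmem : ∀ i j, (i, j) ∈ ofRowLens (List.ofFn n) hsorted ↔ ∃ hi : i < m, j < n ⟨i, hi⟩ := by
      intro i j
      simp [mem_ofRowLens]
    refine ⟨ofRowLens (List.ofFn n) hsorted, ⟨?_, ?_⟩, ?_⟩
    · rintro ⟨i, j⟩ hc
      have hc := (mem_cells_iff_of_colLen_le hlam _).1 hc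
      exact (hmem i j).2 ⟨Finset.mem_range.1 hc.1,
        (Finset.mem_range.1 hc.2).trans_le (hle ⟨i, Finset.mem_range.1 hc.1⟩)⟩
    · by_contra! h
      obtain ⟨hi, -⟩ := (hmem m 0).1 (mem_iff_lt_colLen.2 h)
      exact hi.false
    · funext i
      refine eq_of_forall_lt_iff fun j => ?_
      change j < YoungDiagram.rowLen _ i ↔ _
      rw [← mem_iff_lt_rowLen, hmem]
      simp

lemma powerDet_zero_right {R : Type*} [CommRing R] (x : ℕ → R) (t : R) {m : ℕ} (n : Fin m → ℕ) :
    powerDet x t (fun _ => 0) n = powerDet x 0 (fun j => (j : ℕ)) n := by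
  simp [powerDet]

lemma prod_X_sub_X_ne_zero (m : ℕ) :
    (∏ p ∈ Finset.range m, ∏ i ∈ Finset.range p, (X i - X p : MvPolynomial ℕ ℤ)) ≠ 0 := by
  refine Finset.prod_ne_zero_iff.2 fun p _ => Finset.prod_ne_zero_iff.2 fun i hi => ?_
  rw [sub_ne_zero, Ne, X_injective.eq_iff]
  exact (Finset.mem_range.1 hi).ne

lemma one_add_neg_one_mul_X_ne_zero (i : ℕ) : (1 + (-1) * X i : MvPolynomial ℕ ℤ) ≠ 0 := by
  intro h
  simpa using congrArg (eval 0) h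

/-- The expansion of a Grothendieck polynomial into Schur polynomials, indexed by sequences. -/
lemma tableauSum_neg_one_eq_sum_fillings {m B : ℕ} {l : Fin m → ℕ} (hl : Antitone l)
    (hB : ∀ i, l i + m ≤ B) :
    tableauSum (X : ℕ → MvPolynomial ℕ ℤ) (-1) l = ∑ n ∈ partitionsInBox m B,
      (-1) ^ (∑ i, n i + ∑ i, l i) * ((fillings m l n).card : MvPolynomial ℕ ℤ) *
        tableauSum X 0 n := by
  refine mul_left_cancel₀ (prod_X_sub_X_ne_zero m) ?_
  rw [prod_sub_mul_tableauSum _ _ one_add_neg_one_mul_X_ne_zero l hl,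
    show (fun j : Fin m => (j : ℕ)) = fun j : Fin m => min (j : ℕ) m from
      funext fun j => (min_eq_left j.is_lt.le).symm,
    powerDet_eq_sum_fillings X B m l hl hB, Finset.mul_sum]
  refine Finset.sum_congr rfl fun n hn => ?_
  rw [powerDet_zero_right, ← prod_sub_mul_tableauSum X 0 (by simp) n (mem_partitionsInBox.1 hn).2]
  ring

end Bridge

/-- **Schur expansion of a stable Grothendieck polynomial** (Lenart; equation
(11)): `G_λ(x_1,…,x_m) = Σ_{μ ⊇ λ} (-1)^{|μ/λ|} g_{λμ} s_μ(x_1,…,x_m)`, the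
sum being over partitions `μ ⊇ λ` with at most `m` rows. -/
theorem grothendieck_schur_expansion (lam : YoungDiagram) (m : ℕ) (hm : 1 ≤ m) :
    grothendieck lam.cells m =
      ∑ᶠ (mu : YoungDiagram) (_ : lam ≤ mu ∧ mu.colLen 0 ≤ m),
        ((-1 : ℤ) ^ (mu.card - lam.card) * (gCoeff lam mu : ℤ)) • schurPoly mu m := by
  by_cases h : lam.colLen 0 ≤ m
  · rw [grothendieck_eq_tableauSum h,
      tableauSum_neg_one_eq_sum_fillings (B := lam.rowLen 0 + m) (lam.rows_antitone m)
        fun i => Nat.add_le_add_right (lam.rowLen_anti 0 i (Nat.zero_le _)) m]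
    symm
    refine (finsum_mem_eq_of_bijOn (g := fun n => (-1) ^ (∑ i, n i + ∑ i, lam.rows m i) *
      ((fillings m (lam.rows m) n).card : MvPolynomial ℕ ℤ) * tableauSum X 0 n) _
      (YoungDiagram.bijOn_rows h) ?_).trans (finsum_mem_eq_sum_of_inter_support_eq _ ?_)
    · rintro mu ⟨hle, hmu⟩
      have hcard : lam.card ≤ mu.card := Finset.card_le_card hle
      rw [gCoeff_eq_card_fillings hle hmu, schurPoly_eq_tableauSum hmu,
        ← YoungDiagram.card_eq_sum_rows h, ← YoungDiagram.card_eq_sum_rows hmu,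
        show mu.card + lam.card = mu.card - lam.card + 2 * lam.card by omega, pow_add _ _ (2 * _),
        pow_mul]
      simp [zsmul_eq_mul]
    · ext n
      simp only [Set.mem_inter_iff, Set.mem_ofPred_eq, Finset.mem_coe, mem_partitionsInBox]
      refine and_congr_left fun hn => ?_
      have hne : (fillings m (lam.rows m) n).card ≠ 0 := by
        rintro h0
        simp [h0] at hn
      obtain ⟨f, hf⟩ := Finset.card_ne_zero.1 hne
      rw [mem_fillings] at hf
      constructor
      · refine fun hn => ⟨fun i => (hf.le_add i).trans ?_, hn.1⟩
        exact Nat.add_le_add (lam.rowLen_anti 0 i (Nat.zero_le _)) i.is_lt.le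
      · exact fun hn => ⟨hn.2, hf.le⟩
  · have h1 : ∀ T : SVT lam.cells, ¬ T.Bounded m := fun T hT => h (SVT.colLen_le_of_bounded hT)
    have h2 : ∀ mu : YoungDiagram, ¬ (lam ≤ mu ∧ mu.colLen 0 ≤ m) := by
      rintro mu ⟨hle, hmu⟩
      have h3 := YoungDiagram.mem_iff_lt_colLen.1 (hle (YoungDiagram.mem_iff_lt_colLen.2
        (not_le.1 h)))
      omega
    simp [grothendieck, h1, h2]
end
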